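/- arXiv:2411.02962 — 6 statements merged into one kernel-verified Lean document; each statement's English description precedes it below -/
import Mathlib

section
/- Let g, h be holomorphic functions on 𝔻 such that ∫_𝔻 |g′|² dA < ∞ and φ := g + conj∘h is bounded on 𝔻. Then the following are equivalent: (a) there exists a constant C₁ > 0 such that for every complex polynomial f with f(0) = 0, the function T_φ f is holomorphic on 𝔻 and ∫_𝔻 |(T_φ f)′|² dA ≤ C₁ · ∫_𝔻 |f′|² dA; (b) there exists a constant C > 0 such that for every holomorphic f on 𝔻 with f(0) = 0 and ∫_𝔻 |f′|² dA < ∞ one has ∫_𝔻 |f|² |g′|² dA ≤ C · ∫_𝔻 |f′|² dA (i.e. |∂φ/∂z|² dA is a Carleson measure for 𝒟₀). -/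
open MeasureTheory Metric
open scoped ENNReal ComplexConjugate

/-- The normalized area measure `dA = π⁻¹ · (Lebesgue measure)` on `ℂ`. -/
noncomputable def dA : Measure ℂ := (ENNReal.ofReal (Real.pi)⁻¹) • (volume : Measure ℂ)

/-- The Toeplitz operator with harmonic symbol `φ = g + conj ∘ h` on the Dirichlet space:
`(T_φ f)(w) = ∫_𝔻 (g′(z) f(z) + φ(z) f′(z)) · (w / (1 − w · conj z)) dA(z)`. -/
noncomputable def toeplitz (g φ f : ℂ → ℂ) : ℂ → ℂ :=
  fun w => ∫ z in ball (0 : ℂ) 1,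
    (deriv g z * f z + φ z * deriv f z) * (w / (1 - w * conj z)) ∂dA

open Filter Topology

lemma inner_coeff (F : ℂ → ℂ) (hF : DifferentiableOn ℂ F (ball 0 1)) (n : ℕ) (r : ℝ)
    (h0 : 0 < r) (h1 : r < 1) :
    ∫ θ in Set.Ioo (-Real.pi) Real.pi, F (circleMap 0 r θ) * conj (circleMap 0 r θ) ^ n
      = 2 * Real.pi * (r : ℂ) ^ (2 * n) * (iteratedDeriv n F 0 / n.factorial) := by
  rw [← integral_Ioc_eq_integral_Ioo, ← intervalIntegral.integral_of_le (by linarith [Real.pi_pos])]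
  have hper : Function.Periodic
      (fun θ : ℝ => F (circleMap 0 r θ) * conj (circleMap 0 r θ) ^ n) (2 * Real.pi) := by
    intro θ
    simp only [periodic_circleMap 0 r θ]
  have e1 := hper.intervalIntegral_add_eq (-Real.pi) 0
  rw [show -Real.pi + 2 * Real.pi = Real.pi by ring, zero_add] at e1
  rw [e1]
  have e2 := DifferentiableOn.circleIntegral_one_div_sub_center_pow_smul (f := F) (c := 0) h0 n
    (hF.mono (closedBall_subset_ball h1))
  have hr : (r : ℂ) ≠ 0 := by exact_mod_cast h0.ne'
  have e3 : ∀ θ : ℝ, F (circleMap 0 r θ) * conj (circleMap 0 r θ) ^ n =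
      ((r : ℂ) ^ (2 * n) / Complex.I) * (deriv (circleMap 0 r) θ •
        ((1 / (circleMap 0 r θ - 0) ^ (n + 1)) • F (circleMap 0 r θ))) := by
    intro θ
    have hz : circleMap 0 r θ ≠ 0 := circleMap_ne_center h0.ne'
    have hc : conj (circleMap 0 r θ) = (r : ℂ) ^ 2 / circleMap 0 r θ := by
      rw [eq_div_iff hz, mul_comm, Complex.mul_conj, Complex.normSq_eq_norm_sq]
      simp
    rw [hc, deriv_circleMap, div_pow, ← pow_mul]
    simp only [smul_eq_mul, sub_zero]
    have := Complex.I_ne_zero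
    field_simp
    ring
  rw [circleIntegral] at e2
  simp_rw [e3]
  rw [intervalIntegral.integral_const_mul, e2]
  have := Complex.I_ne_zero
  simp only [smul_eq_mul]
  field_simp

lemma area_coeff (F : ℂ → ℂ) (hF : DifferentiableOn ℂ F (ball 0 1))
    (hi : Integrable F (dA.restrict (ball 0 1))) (n : ℕ) :
    ∫ z in ball (0 : ℂ) 1, F z * conj z ^ n ∂dA
      = (iteratedDeriv n F 0 / n.factorial) / (n + 1) := by
  have hpi : (ENNReal.ofReal (Real.pi)⁻¹) ≠ 0 := by simp [Real.pi_pos]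
  have hi' : IntegrableOn F (ball 0 1) volume := by
    rw [dA, Measure.restrict_smul] at hi
    exact (integrable_smul_measure hpi (by simp)).1 hi
  set G : ℂ → ℂ := (ball (0 : ℂ) 1).indicator (fun z => F z * conj z ^ n) with hG
  have hGi : Integrable G volume := by
    rw [hG, integrable_indicator_iff measurableSet_ball]
    refine Integrable.mono (g := F) hi' ?_ ?_
    · exact hi'.aestronglyMeasurable.mul (by fun_prop)
    · refine (ae_restrict_iff' measurableSet_ball).2 (Eventually.of_forall fun z hz => ?_)
      rw [norm_mul, norm_pow, Complex.norm_conj]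
      rw [mem_ball_zero_iff] at hz
      exact mul_le_of_le_one_right (norm_nonneg _) (pow_le_one₀ (norm_nonneg _) hz.le)
  have hsymm : ∀ p : ℝ × ℝ, Complex.polarCoord.symm p = circleMap 0 p.1 p.2 := by
    intro p
    rw [Complex.polarCoord_symm_apply, circleMap, Complex.exp_mul_I]
    push_cast; ring
  have hmeas : MeasurableSet (Set.Ioi (0:ℝ) ×ˢ Set.Ioo (-Real.pi) Real.pi) :=
    measurableSet_Ioi.prod measurableSet_Ioo
  have hpol : IntegrableOn (fun p : ℝ × ℝ => p.1 • G (circleMap 0 p.1 p.2))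
      (Set.Ioi (0:ℝ) ×ˢ Set.Ioo (-Real.pi) Real.pi) (volume.prod volume) := by
    have hcm : Continuous (fun p : ℝ × ℝ => circleMap 0 p.1 p.2) := by
      unfold circleMap; fun_prop
    constructor
    · have : (fun p : ℝ × ℝ => p.1 • G (circleMap 0 p.1 p.2)) =
        ((fun p : ℝ × ℝ => circleMap 0 p.1 p.2) ⁻¹' (ball 0 1)).indicator
          (fun p : ℝ × ℝ => p.1 • (F (circleMap 0 p.1 p.2) * conj (circleMap 0 p.1 p.2) ^ n)) := by
        ext p
        by_cases hp : circleMap 0 p.1 p.2 ∈ ball (0:ℂ) 1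
        · rw [hG, Set.indicator_of_mem hp, Set.indicator_of_mem (by exact hp)]
        · rw [hG, Set.indicator_of_notMem hp, Set.indicator_of_notMem (by exact hp), smul_zero]
      rw [this]
      have hs : MeasurableSet ((fun p : ℝ × ℝ => circleMap 0 p.1 p.2) ⁻¹' (ball 0 1)) :=
        hcm.measurable measurableSet_ball
      rw [aestronglyMeasurable_indicator_iff hs]
      refine AEStronglyMeasurable.mono_measure ?_ (Measure.restrict_mono le_rfl Measure.restrict_le_self)
      apply ContinuousOn.aestronglyMeasurable _ hs
      refine ContinuousOn.smul continuous_fst.continuousOn (ContinuousOn.mul ?_ ?_)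
      · exact hF.continuousOn.comp hcm.continuousOn (fun p hp => hp)
      · fun_prop
    · have := Complex.lintegral_comp_polarCoord_symm (fun z => ‖G z‖ₑ)
      rw [HasFiniteIntegral]
      refine lt_of_le_of_lt (le_of_eq ?_) hGi.2
      rw [← this]
      refine setLIntegral_congr_fun hmeas (fun p hp => ?_)
      have hp1 : 0 < p.1 := hp.1
      simp only [enorm_smul, hsymm, smul_eq_mul]
      rw [Real.enorm_eq_ofReal hp1.le]
  have key : ∫ z, G z = Real.pi * ((iteratedDeriv n F 0 / n.factorial) / (n + 1)) := by
    rw [← Complex.integral_comp_polarCoord_symm]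
    simp_rw [hsymm]
    change ∫ p in Set.Ioi (0:ℝ) ×ˢ Set.Ioo (-Real.pi) Real.pi, _ ∂(volume.prod volume) = _
    rw [setIntegral_prod _ hpol]
    have : ∀ r ∈ Set.Ioi (0:ℝ), (∫ θ in Set.Ioo (-Real.pi) Real.pi, r • G (circleMap 0 r θ)) =
        (Set.Iio (1:ℝ)).indicator (fun r : ℝ => ((r ^ (2 * n + 1) : ℝ) : ℂ) *
          (2 * Real.pi * (iteratedDeriv n F 0 / n.factorial))) r := by
      intro r hr
      have hr : 0 < r := hr
      by_cases h1 : r < 1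
      · rw [Set.indicator_of_mem (by exact h1), integral_smul]
        have : ∀ θ, G (circleMap 0 r θ) = F (circleMap 0 r θ) * conj (circleMap 0 r θ) ^ n := by
          intro θ
          rw [hG, Set.indicator_of_mem]
          simp [abs_of_pos hr, h1]
        simp_rw [this]
        rw [inner_coeff F hF n r hr h1]
        simp only [Complex.real_smul]
        push_cast; ring
      · rw [Set.indicator_of_notMem (by exact h1)]
        have : ∀ θ, G (circleMap 0 r θ) = 0 := by
          intro θ
          rw [hG, Set.indicator_of_notMem]
          simpa [abs_of_pos hr] using h1
        simp [this]
    rw [setIntegral_congr_fun measurableSet_Ioi this, setIntegral_indicator measurableSet_Iio,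
      Set.Ioi_inter_Iio, ← integral_Ioc_eq_integral_Ioo,
      ← intervalIntegral.integral_of_le zero_le_one, intervalIntegral.integral_mul_const,
      intervalIntegral.integral_ofReal, integral_pow]
    have : (n : ℂ) + 1 ≠ 0 := by exact_mod_cast Nat.succ_ne_zero n
    have h2 : (2 * n + 1 + 1 : ℂ) ≠ 0 := by
      have : (2 * n + 1 + 1 : ℂ) = ((2 * n + 1 + 1 : ℕ) : ℂ) := by push_cast; ring
      rw [this]; exact Nat.cast_ne_zero.2 (Nat.succ_ne_zero _)
    push_cast
    simp only [one_pow, ne_eq, Nat.succ_ne_zero, not_false_eq_true, zero_pow, sub_zero]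
    field_simp
    ring
  rw [dA, Measure.restrict_smul, integral_smul_measure, ← integral_indicator measurableSet_ball,
    ← hG, key, ENNReal.toReal_ofReal (by positivity), Complex.real_smul, ← mul_assoc,
    ← Complex.ofReal_mul, inv_mul_cancel₀ Real.pi_ne_zero]
  simp

lemma hasSum_congr_aux {f g : ℕ → ℂ} {a : ℂ} (h : ∀ n, f n = g n) : HasSum f a ↔ HasSum g a := by
  rw [funext h]

/-- Coefficients against the monomials. -/
noncomputable def cf (u : ℂ → ℂ) (n : ℕ) : ℂ := ∫ z in ball (0 : ℂ) 1, u z * conj z ^ n ∂dA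

/-- The disc measure. -/
noncomputable abbrev mu : Measure ℂ := dA.restrict (ball (0 : ℂ) 1)

instance : IsFiniteMeasure mu := by
  constructor
  rw [Measure.restrict_apply_univ, dA, Measure.smul_apply, smul_eq_mul]
  exact ENNReal.mul_lt_top (by simp) measure_ball_lt_top

lemma ae_mu {p : ℂ → Prop} (h : ∀ z ∈ ball (0 : ℂ) 1, p z) : ∀ᵐ z ∂mu, p z :=
  (ae_restrict_iff' measurableSet_ball).2 (Eventually.of_forall h)

lemma cf_integrable {u : ℂ → ℂ} (hu : Integrable u mu) (n : ℕ) :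
    Integrable (fun z => u z * conj z ^ n) mu := by
  refine hu.mono (hu.aestronglyMeasurable.mul (by fun_prop)) (ae_mu fun z hz => ?_)
  rw [norm_mul, norm_pow, Complex.norm_conj]
  rw [mem_ball_zero_iff] at hz
  exact mul_le_of_le_one_right (norm_nonneg _) (pow_le_one₀ (norm_nonneg _) hz.le)

lemma cf_norm_le {u : ℂ → ℂ} (hu : Integrable u mu) (n : ℕ) : ‖cf u n‖ ≤ ∫ z, ‖u z‖ ∂mu := by
  refine (norm_integral_le_integral_norm _).trans ?_
  refine integral_mono_ae (cf_integrable hu n).norm hu.norm (ae_mu fun z hz => ?_)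
  simp only [norm_mul, norm_pow, Complex.norm_conj]
  rw [mem_ball_zero_iff] at hz
  exact mul_le_of_le_one_right (norm_nonneg _) (pow_le_one₀ (norm_nonneg _) hz.le)

/-- The integral transform behind the Toeplitz operator. -/
noncomputable def TT (u : ℂ → ℂ) (w : ℂ) : ℂ :=
  ∫ z in ball (0 : ℂ) 1, u z * (w / (1 - w * conj z)) ∂dA

lemma TT_hasSum {u : ℂ → ℂ} (hu : Integrable u mu) {w : ℂ} (hw : w ∈ ball (0 : ℂ) 1) :
    HasSum (fun n => cf u n * w ^ (n + 1)) (TT u w) := by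
  rw [mem_ball_zero_iff] at hw
  have : ∀ n, cf u n * w ^ (n + 1) = ∫ z, u z * conj z ^ n * w ^ (n + 1) ∂mu := by
    intro n
    rw [cf, integral_mul_const]
  simp_rw [this]
  refine hasSum_integral_of_dominated_convergence (fun n z => ‖u z‖ * ‖w‖ ^ n) ?_ ?_ ?_ ?_ ?_
  · intro n
    exact ((cf_integrable hu n).mul_const _).aestronglyMeasurable
  · intro n
    refine ae_mu fun z hz => ?_
    rw [mem_ball_zero_iff] at hz
    rw [norm_mul, norm_mul, norm_pow, norm_pow, Complex.norm_conj]
    have h1 : ‖z‖ ^ n ≤ 1 := pow_le_one₀ (norm_nonneg _) hz.le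
    have h2 : ‖w‖ ^ (n + 1) ≤ ‖w‖ ^ n := pow_le_pow_of_le_one (norm_nonneg _) hw.le (Nat.le_succ n)
    exact mul_le_mul (mul_le_of_le_one_right (norm_nonneg _) h1) h2 (by positivity) (norm_nonneg _)
  · exact Eventually.of_forall fun z =>
      (summable_geometric_of_lt_one (norm_nonneg _) hw).mul_left _
  · simp_rw [tsum_mul_left]
    exact hu.norm.mul_const _
  · refine ae_mu fun z hz => ?_
    rw [mem_ball_zero_iff] at hz
    have hlt : ‖w * conj z‖ < 1 := by
      rw [norm_mul, Complex.norm_conj]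
      nlinarith [norm_nonneg w, norm_nonneg z]
    have := ((hasSum_geometric_of_norm_lt_one hlt).mul_left (u z * w))
    have e : u z * (w / (1 - w * conj z)) = u z * w * (1 - w * conj z)⁻¹ := by
      rw [div_eq_mul_inv]; ring
    rw [e]
    exact (hasSum_congr_aux fun n => by rw [mul_pow]; ring).2 this

lemma TT_deriv_aux {u : ℂ → ℂ} (hu : Integrable u mu) {w : ℂ} (hw : w ∈ ball (0 : ℂ) 1) :
    DifferentiableAt ℂ (TT u) w ∧
      HasSum (fun n : ℕ => (n + 1) * cf u n * w ^ n) (deriv (TT u) w) := by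
  obtain ⟨r, hwr, hr1⟩ := exists_between (mem_ball_zero_iff.1 hw)
  have hr0 : 0 ≤ r := (norm_nonneg _).trans hwr.le
  have hsum : Summable (fun n : ℕ => (∫ z, ‖u z‖ ∂mu) * r ^ n) :=
    (summable_geometric_of_lt_one hr0 hr1).mul_left _
  have hd : ∀ n : ℕ, DifferentiableOn ℂ (fun w => cf u n * w ^ (n + 1)) (ball (0 : ℂ) r) :=
    fun n => by fun_prop
  have hle : ∀ (n : ℕ) (w : ℂ), w ∈ ball (0 : ℂ) r →
      ‖cf u n * w ^ (n + 1)‖ ≤ (∫ z, ‖u z‖ ∂mu) * r ^ n := by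
    intro n w hw
    rw [mem_ball_zero_iff] at hw
    rw [norm_mul, norm_pow]
    have h1 : ‖w‖ ^ (n + 1) ≤ r ^ (n + 1) := pow_le_pow_left₀ (norm_nonneg _) hw.le _
    have h2 : r ^ (n + 1) ≤ r ^ n := pow_le_pow_of_le_one hr0 hr1.le (Nat.le_succ n)
    exact mul_le_mul (cf_norm_le hu n) (h1.trans h2) (by positivity)
      (integral_nonneg fun _ => norm_nonneg _)
  have hwr' : w ∈ ball (0 : ℂ) r := mem_ball_zero_iff.2 hwr
  have heq : (fun w => ∑' n : ℕ, cf u n * w ^ (n + 1)) =ᶠ[𝓝 w] TT u := by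
    filter_upwards [isOpen_ball.mem_nhds hwr'] with x hx
    exact (TT_hasSum hu (ball_subset_ball hr1.le hx)).tsum_eq
  constructor
  · have := (Complex.differentiableOn_tsum_of_summable_norm hsum hd isOpen_ball hle).differentiableAt
      (isOpen_ball.mem_nhds hwr')
    exact heq.differentiableAt_iff.1 this
  · have := Complex.hasSum_deriv_of_summable_norm hsum hd isOpen_ball hle hwr'
    rw [heq.deriv_eq] at this
    refine (hasSum_congr_aux fun n => ?_).2 this
    rw [deriv_const_mul _ (by fun_prop)]
    simp
    ring

lemma iteratedDeriv_monomial (m n : ℕ) :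
    iteratedDeriv n (fun z : ℂ => z ^ m) 0 / n.factorial = if m = n then 1 else 0 := by
  rw [iteratedDeriv_fun_pow_zero]
  have : (n.factorial : ℂ) ≠ 0 := Nat.cast_ne_zero.2 n.factorial_ne_zero
  by_cases h : m = n
  · subst h; simp [this]
  · simp [h, Ne.symm h]

lemma integrable_of_cont {f : ℂ → ℂ} (hf : Continuous f) (p : ℝ≥0∞) : MemLp f p mu := by
  obtain ⟨C, hC⟩ := (isCompact_closedBall (0 : ℂ) 1).exists_bound_of_continuousOn hf.continuousOn
  exact MemLp.of_bound hf.aestronglyMeasurable C (ae_mu fun z hz => hC z (ball_subset_closedBall hz))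

lemma cf_monomial (m n : ℕ) :
    cf (fun z => z ^ m) n = if m = n then 1 / ((n : ℂ) + 1) else 0 := by
  rw [cf, area_coeff _ (by fun_prop)
    (memLp_one_iff_integrable.1 (integrable_of_cont (by fun_prop) 1)), iteratedDeriv_monomial]
  split_ifs <;> simp

/-- Partial sums of the Bergman projection. -/
noncomputable def PN (u : ℂ → ℂ) (N : ℕ) (w : ℂ) : ℂ :=
  ∑ n ∈ Finset.range N, (n + 1) * cf u n * w ^ n

lemma PN_cont (u : ℂ → ℂ) (N : ℕ) : Continuous (PN u N) := by
  unfold PN; fun_prop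

lemma cf_PN (u : ℂ → ℂ) (N n : ℕ) (hn : n < N) : cf (PN u N) n = cf u n := by
  have h1 : cf (PN u N) n = ∑ m ∈ Finset.range N, (m + 1) * cf u m * cf (fun z => z ^ m) n := by
    rw [cf]
    simp_rw [PN, Finset.sum_mul]
    rw [integral_finsetSum]
    · refine Finset.sum_congr rfl fun m _ => ?_
      rw [cf.eq_1 (fun z => z ^ m), ← integral_const_mul]
      simp_rw [mul_assoc]
    · intro m _
      exact memLp_one_iff_integrable.1 (integrable_of_cont (by fun_prop) 1)
  rw [h1]
  simp_rw [cf_monomial]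
  rw [Finset.sum_eq_single n]
  · have : (n : ℂ) + 1 ≠ 0 := by exact_mod_cast Nat.succ_ne_zero n
    simp only [if_true]
    field_simp
  · intro m _ hm; simp [hm]
  · intro h; exact absurd (Finset.mem_range.2 hn) h

lemma inner_PN (u : ℂ → ℂ) (N : ℕ) {x : ℂ → ℂ} (hx : MemLp x 2 mu) :
    inner ℂ ((integrable_of_cont (PN_cont u N) 2).toLp (PN u N)) (hx.toLp x)
      = ∑ n ∈ Finset.range N, conj ((n + 1) * cf u n) * cf x n := by
  rw [L2.inner_def]
  have h1 : ∀ᵐ a ∂mu, inner ℂ (((integrable_of_cont (PN_cont u N) 2).toLp (PN u N) : ℂ → ℂ) a)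
      ((hx.toLp x : ℂ → ℂ) a) = ∑ n ∈ Finset.range N, conj ((n + 1) * cf u n) * (x a * conj a ^ n) := by
    filter_upwards [(integrable_of_cont (PN_cont u N) 2).coeFn_toLp, hx.coeFn_toLp] with a h1 h2
    rw [h1, h2, RCLike.inner_apply, PN, map_sum, Finset.mul_sum]
    refine Finset.sum_congr rfl fun n _ => ?_
    simp only [map_mul, map_pow]
    ring
  rw [integral_congr_ae h1, integral_finsetSum]
  · refine Finset.sum_congr rfl fun n _ => ?_
    rw [integral_const_mul, cf.eq_1 x]
  · intro n _
    exact (cf_integrable (hx.integrable one_le_two) n).const_mul _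

lemma lint_eq (f : ℂ → ℂ) : ∫⁻ z, (‖f z‖₊ : ℝ≥0∞) ^ 2 ∂mu = eLpNorm f 2 mu ^ 2 := by
  have := eLpNorm_nnreal_pow_eq_lintegral (f := f) (μ := mu) (p := 2) two_ne_zero
  simp only [NNReal.coe_ofNat, ENNReal.rpow_ofNat, ENNReal.coe_ofNat] at this
  rw [this]
  rfl

lemma PN_le {u : ℂ → ℂ} (hu : MemLp u 2 mu) (N : ℕ) :
    ∫⁻ z, (‖PN u N z‖₊ : ℝ≥0∞) ^ 2 ∂mu ≤ ∫⁻ z, (‖u z‖₊ : ℝ≥0∞) ^ 2 ∂mu := by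
  rw [lint_eq, lint_eq]
  have hP := integrable_of_cont (PN_cont u N) 2
  rw [← Lp.enorm_toLp hP, ← Lp.enorm_toLp hu]
  have e : inner ℂ (hP.toLp (PN u N)) (hP.toLp (PN u N)) =
      inner ℂ (hP.toLp (PN u N)) (hu.toLp u) := by
    rw [inner_PN u N hP, inner_PN u N hu]
    refine Finset.sum_congr rfl fun n hn => ?_
    rw [cf_PN u N n (Finset.mem_range.1 hn)]
  have hle : ‖hP.toLp (PN u N)‖ ≤ ‖hu.toLp u‖ := by
    have h1 : ‖hP.toLp (PN u N)‖ ^ 2 ≤ ‖hP.toLp (PN u N)‖ * ‖hu.toLp u‖ := by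
      have := norm_inner_le_norm (𝕜 := ℂ) (hP.toLp (PN u N)) (hu.toLp u)
      rw [← e, inner_self_eq_norm_sq_to_K] at this
      simpa using this
    by_contra! hc
    nlinarith [norm_nonneg (hu.toLp u)]
  have : ‖hP.toLp (PN u N)‖ₑ ≤ ‖hu.toLp u‖ₑ := enorm_le_iff_norm_le.2 hle
  gcongr

lemma fatou {F : ℕ → ℂ → ℂ} {f G : ℂ → ℂ} {B : ℝ≥0∞} (hF : ∀ n, Continuous (F n))
    (hG : AEStronglyMeasurable G mu)
    (hlim : ∀ z ∈ ball (0 : ℂ) 1, Tendsto (fun n => F n z) atTop (𝓝 (f z)))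
    (hB : ∀ n, ∫⁻ z, (‖F n z‖₊ : ℝ≥0∞) ^ 2 * (‖G z‖₊ : ℝ≥0∞) ^ 2 ∂mu ≤ B) :
    ∫⁻ z, (‖f z‖₊ : ℝ≥0∞) ^ 2 * (‖G z‖₊ : ℝ≥0∞) ^ 2 ∂mu ≤ B := by
  have h1 : ∫⁻ z, (‖f z‖₊ : ℝ≥0∞) ^ 2 * (‖G z‖₊ : ℝ≥0∞) ^ 2 ∂mu =
      ∫⁻ z, liminf (fun n => (‖F n z‖₊ : ℝ≥0∞) ^ 2 * (‖G z‖₊ : ℝ≥0∞) ^ 2) atTop ∂mu := by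
    refine lintegral_congr_ae (ae_mu fun z hz => ?_)
    refine (Tendsto.liminf_eq ?_).symm
    refine ENNReal.Tendsto.mul_const ?_ (Or.inr (by simp))
    have h2 : Continuous (fun x : ℂ => (‖x‖₊ : ℝ≥0∞) ^ 2) := by fun_prop
    exact (h2.tendsto (f z)).comp (hlim z hz)
  rw [h1]
  refine (lintegral_liminf_le' fun n => ?_).trans ?_
  · have : AEMeasurable (fun z => (‖G z‖₊ : ℝ≥0∞)) mu := hG.aemeasurable.nnnorm.coe_nnreal_ennreal
    have h3 : AEMeasurable (fun z => (‖F n z‖₊ : ℝ≥0∞)) mu :=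
      (hF n).aemeasurable.nnnorm.coe_nnreal_ennreal
    exact (h3.pow_const 2).mul (this.pow_const 2)
  · refine liminf_le_of_frequently_le' (Frequently.of_forall hB)

lemma TT_deriv_le {u : ℂ → ℂ} (hu : MemLp u 2 mu) :
    ∫⁻ w, (‖deriv (TT u) w‖₊ : ℝ≥0∞) ^ 2 ∂mu ≤ ∫⁻ z, (‖u z‖₊ : ℝ≥0∞) ^ 2 ∂mu := by
  have := fatou (F := PN u) (f := deriv (TT u)) (G := fun _ => 1) (PN_cont u)
    aestronglyMeasurable_const
    (fun z hz => (TT_deriv_aux (hu.integrable one_le_two) hz).2.tendsto_sum_nat)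
    (fun n => by simpa using PN_le hu n)
  simpa using this

lemma cf_holo {F : ℂ → ℂ} (hF : DifferentiableOn ℂ F (ball 0 1)) (hi : Integrable F mu) (n : ℕ) :
    (n + 1) * cf F n = iteratedDeriv n F 0 / n.factorial := by
  rw [cf, area_coeff F hF hi]
  have : (n : ℂ) + 1 ≠ 0 := by exact_mod_cast Nat.succ_ne_zero n
  field_simp

lemma TT_repr {F : ℂ → ℂ} (hF : DifferentiableOn ℂ F (ball 0 1)) (hi : Integrable F mu)
    {w : ℂ} (hw : w ∈ ball (0 : ℂ) 1) : deriv (TT F) w = F w := by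
  refine (TT_deriv_aux hi hw).2.unique ?_
  have := Complex.hasSum_taylorSeries_on_ball hF hw
  refine (hasSum_congr_aux fun n => ?_).2 this
  rw [cf_holo hF hi]
  simp only [smul_eq_mul, sub_zero]
  ring

lemma lint_add_le {a b : ℂ → ℂ} (ha : AEMeasurable a mu) :
    ∫⁻ z, (‖a z + b z‖₊ : ℝ≥0∞) ^ 2 ∂mu ≤
      2 * ∫⁻ z, (‖a z‖₊ : ℝ≥0∞) ^ 2 ∂mu + 2 * ∫⁻ z, (‖b z‖₊ : ℝ≥0∞) ^ 2 ∂mu := by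
  rw [← lintegral_const_mul' _ _ (by simp), ← lintegral_const_mul' _ _ (by simp),
    ← lintegral_add_left' ((ha.nnnorm.coe_nnreal_ennreal.pow_const 2).const_mul 2)]
  refine lintegral_mono fun z => ?_
  have h : ‖a z + b z‖₊ ^ 2 ≤ 2 * ‖a z‖₊ ^ 2 + 2 * ‖b z‖₊ ^ 2 := by
    rw [← NNReal.coe_le_coe]
    push_cast
    have := norm_add_le (a z) (b z)
    nlinarith [norm_nonneg (a z + b z), sq_nonneg (‖a z‖ - ‖b z‖), norm_nonneg (a z),
      norm_nonneg (b z)]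
  have h' : ((‖a z + b z‖₊ ^ 2 : NNReal) : ℝ≥0∞) ≤ ((2 * ‖a z‖₊ ^ 2 + 2 * ‖b z‖₊ ^ 2 : NNReal) : ℝ≥0∞) :=
    ENNReal.coe_le_coe.2 h
  simpa using h'

lemma lint_mul_le {φ b : ℂ → ℂ} {M : ℝ} (hM : ∀ z ∈ ball (0 : ℂ) 1, ‖φ z‖ ≤ M) :
    ∫⁻ z, (‖φ z * b z‖₊ : ℝ≥0∞) ^ 2 ∂mu ≤
      ENNReal.ofReal (M ^ 2) * ∫⁻ z, (‖b z‖₊ : ℝ≥0∞) ^ 2 ∂mu := by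
  rw [← lintegral_const_mul' _ _ (by simp)]
  refine lintegral_mono_ae (ae_mu fun z hz => ?_)
  have h1 : (‖φ z‖₊ : ℝ≥0∞) ^ 2 ≤ ENNReal.ofReal (M ^ 2) := by
    rw [ENNReal.ofReal_pow ((norm_nonneg _).trans (hM z hz))]
    gcongr
    rw [← enorm_eq_nnnorm, ← ofReal_norm]
    exact ENNReal.ofReal_le_ofReal (hM z hz)
  rw [nnnorm_mul, ENNReal.coe_mul, mul_pow]
  gcongr

lemma TT_add_deriv {a b : ℂ → ℂ} (ha : Integrable a mu) (hb : Integrable b mu)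
    {w : ℂ} (hw : w ∈ ball (0 : ℂ) 1) :
    deriv (TT (fun z => a z + b z)) w = deriv (TT a) w + deriv (TT b) w := by
  refine (TT_deriv_aux (ha.add hb) hw).2.unique ?_
  refine (hasSum_congr_aux fun n => ?_).2 ((TT_deriv_aux ha hw).2.add (TT_deriv_aux hb hw).2)
  have : cf (fun z => a z + b z) n = cf a n + cf b n := by
    rw [cf, cf, cf, ← integral_add (cf_integrable ha n) (cf_integrable hb n)]
    simp_rw [add_mul]
  change (n + 1) * cf (fun z => a z + b z) n * w ^ n = _
  rw [this]; ring

lemma const_combine {C D : ℝ} (hC : 0 ≤ C) (hD : 0 ≤ D) (X : ℝ≥0∞) :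
    2 * (ENNReal.ofReal C * X) + 2 * (ENNReal.ofReal D * X) =
      ENNReal.ofReal (2 * C + 2 * D) * X := by
  rw [ENNReal.ofReal_add (by positivity) (by positivity), ENNReal.ofReal_mul (by norm_num),
    ENNReal.ofReal_mul (by norm_num)]
  simp only [ENNReal.ofReal_ofNat]
  ring

lemma memLp_of_lint {f : ℂ → ℂ} (hf : AEStronglyMeasurable f mu)
    (h : ∫⁻ z, (‖f z‖₊ : ℝ≥0∞) ^ 2 ∂mu < ⊤) : MemLp f 2 mu := by
  refine ⟨hf, ?_⟩
  rw [lint_eq] at h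
  by_contra hc
  rw [not_lt, top_le_iff] at hc
  simp [hc] at h

lemma poly_facts {g h φ : ℂ → ℂ}
    (hg : DifferentiableOn ℂ g (ball (0 : ℂ) 1))
    (hh : DifferentiableOn ℂ h (ball (0 : ℂ) 1))
    (hgD : (∫⁻ z in ball (0 : ℂ) 1, (‖deriv g z‖₊ : ℝ≥0∞) ^ 2 ∂dA) < ⊤)
    (hφ : ∀ z, φ z = g z + conj (h z))
    {M : ℝ} (hM : ∀ z ∈ ball (0 : ℂ) 1, ‖φ z‖ ≤ M) (f : Polynomial ℂ) :
    MemLp (fun z => deriv g z * f.eval z) 2 mu ∧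
      MemLp (fun z => φ z * deriv (fun x => f.eval x) z) 2 mu := by
  have hg' : DifferentiableOn ℂ (deriv g) (ball (0 : ℂ) 1) := hg.deriv isOpen_ball
  have hgm : AEStronglyMeasurable (deriv g) mu :=
    hg'.continuousOn.aestronglyMeasurable measurableSet_ball
  have hgL := memLp_of_lint hgm hgD
  have hfc : Continuous (fun z => f.eval z) := f.continuous
  have hfd : Continuous (deriv (fun x => f.eval x)) := by
    have : deriv (fun x => f.eval x) = fun x => f.derivative.eval x := by
      ext x; exact f.deriv
    rw [this]; exact f.derivative.continuous
  obtain ⟨K, hK⟩ := (isCompact_closedBall (0 : ℂ) 1).exists_bound_of_continuousOn hfc.continuousOn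
  have hφm : AEStronglyMeasurable φ mu := by
    have : ContinuousOn φ (ball (0 : ℂ) 1) := by
      have e : φ = fun z => g z + conj (h z) := funext hφ
      rw [e]
      exact hg.continuousOn.add (Complex.continuous_conj.comp_continuousOn hh.continuousOn)
    exact this.aestronglyMeasurable measurableSet_ball
  constructor
  · refine hgL.of_le_mul (c := K) (hgm.mul hfc.aestronglyMeasurable) (ae_mu fun z hz => ?_)
    rw [norm_mul, mul_comm]
    exact mul_le_mul_of_nonneg_right (hK z (ball_subset_closedBall hz)) (norm_nonneg _)
  · refine (integrable_of_cont hfd 2).of_le_mul (c := M) (hφm.mul hfd.aestronglyMeasurable)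
      (ae_mu fun z hz => ?_)
    rw [norm_mul]
    exact mul_le_mul_of_nonneg_right (hM z hz) (norm_nonneg _)

lemma approx {f : ℂ → ℂ} (hf : DifferentiableOn ℂ f (ball (0 : ℂ) 1)) (hf0 : f 0 = 0)
    (hfD : (∫⁻ z in ball (0 : ℂ) 1, (‖deriv f z‖₊ : ℝ≥0∞) ^ 2 ∂dA) < ⊤) :
    ∃ p : ℕ → Polynomial ℂ, (∀ N, (p N).eval 0 = 0) ∧
      (∀ z ∈ ball (0 : ℂ) 1, Tendsto (fun N => (p N).eval z) atTop (𝓝 (f z))) ∧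
      ∀ N, ∫⁻ z, (‖deriv (fun x => (p N).eval x) z‖₊ : ℝ≥0∞) ^ 2 ∂mu ≤
        ∫⁻ z, (‖deriv f z‖₊ : ℝ≥0∞) ^ 2 ∂mu := by
  have hf' : DifferentiableOn ℂ (deriv f) (ball (0 : ℂ) 1) := hf.deriv isOpen_ball
  have hfL : MemLp (deriv f) 2 mu :=
    memLp_of_lint (hf'.continuousOn.aestronglyMeasurable measurableSet_ball) hfD
  refine ⟨fun N => ∑ n ∈ Finset.range N,
    Polynomial.C (cf (deriv f) n) * Polynomial.X ^ (n + 1), ?_, ?_, ?_⟩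
  · intro N
    simp [Polynomial.eval_finsetSum]
  · intro z hz
    have h1 := Complex.hasSum_taylorSeries_on_ball hf hz
    rw [← hasSum_nat_add_iff' 1] at h1
    simp only [Finset.range_one, Finset.sum_singleton, iteratedDeriv_zero, hf0, smul_zero,
      sub_zero] at h1
    have h2 : HasSum (fun n => cf (deriv f) n * z ^ (n + 1)) (f z) := by
      refine (hasSum_congr_aux fun n => ?_).2 h1
      have h3 := cf_holo hf' (hfL.integrable one_le_two) n
      rw [← iteratedDeriv_succ'] at h3
      have hn : (n : ℂ) + 1 ≠ 0 := by exact_mod_cast Nat.succ_ne_zero n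
      have hn' : (n.factorial : ℂ) ≠ 0 := Nat.cast_ne_zero.2 n.factorial_ne_zero
      have h4 : iteratedDeriv (n + 1) f 0 = (n + 1) * cf (deriv f) n * n.factorial := by
        rw [h3]; field_simp
      rw [h4, Nat.factorial_succ]
      push_cast
      simp only [smul_eq_mul]
      field_simp
    refine h2.tendsto_sum_nat.congr fun N => ?_
    simp [Polynomial.eval_finsetSum]
  · intro N
    refine le_trans (le_of_eq ?_) (PN_le hfL N)
    refine lintegral_congr fun z => ?_
    rw [Polynomial.deriv, PN]
    simp only [Polynomial.derivative_sum, Polynomial.eval_finsetSum]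
    congr 3
    refine Finset.sum_congr rfl fun n _ => ?_
    simp
    ring

theorem statement0 (g h : ℂ → ℂ)
    (hg : DifferentiableOn ℂ g (ball (0 : ℂ) 1))
    (hh : DifferentiableOn ℂ h (ball (0 : ℂ) 1))
    (hgD : (∫⁻ z in ball (0 : ℂ) 1, (‖deriv g z‖₊ : ℝ≥0∞) ^ 2 ∂dA) < ⊤)
    (φ : ℂ → ℂ) (hφ : ∀ z, φ z = g z + conj (h z))
    (hbdd : ∃ M : ℝ, ∀ z ∈ ball (0 : ℂ) 1, ‖φ z‖ ≤ M) :
    (∃ C₁ : ℝ, 0 < C₁ ∧ ∀ f : Polynomial ℂ, f.eval 0 = 0 →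
        DifferentiableOn ℂ (toeplitz g φ (fun z => f.eval z)) (ball (0 : ℂ) 1) ∧
        (∫⁻ w in ball (0 : ℂ) 1,
            (‖deriv (toeplitz g φ (fun z => f.eval z)) w‖₊ : ℝ≥0∞) ^ 2 ∂dA)
          ≤ ENNReal.ofReal C₁ *
            ∫⁻ z in ball (0 : ℂ) 1, (‖deriv (fun x => f.eval x) z‖₊ : ℝ≥0∞) ^ 2 ∂dA) ↔
    (∃ C : ℝ, 0 < C ∧ ∀ f : ℂ → ℂ, DifferentiableOn ℂ f (ball (0 : ℂ) 1) → f 0 = 0 →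
        (∫⁻ z in ball (0 : ℂ) 1, (‖deriv f z‖₊ : ℝ≥0∞) ^ 2 ∂dA) < ⊤ →
        (∫⁻ z in ball (0 : ℂ) 1, (‖f z‖₊ : ℝ≥0∞) ^ 2 * (‖deriv g z‖₊ : ℝ≥0∞) ^ 2 ∂dA)
          ≤ ENNReal.ofReal C *
            ∫⁻ z in ball (0 : ℂ) 1, (‖deriv f z‖₊ : ℝ≥0∞) ^ 2 ∂dA) := by
  obtain ⟨M, hM⟩ := hbdd
  have hg' : DifferentiableOn ℂ (deriv g) (ball (0 : ℂ) 1) := hg.deriv isOpen_ball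
  have hgm : AEStronglyMeasurable (deriv g) mu :=
    hg'.continuousOn.aestronglyMeasurable measurableSet_ball
  constructor
  · rintro ⟨C₁, hC₁, H⟩
    refine ⟨2 * C₁ + 2 * M ^ 2, by positivity, fun f hf hf0 hfD => ?_⟩
    have hpoly : ∀ p : Polynomial ℂ, p.eval 0 = 0 →
        ∫⁻ z, (‖p.eval z‖₊ : ℝ≥0∞) ^ 2 * (‖deriv g z‖₊ : ℝ≥0∞) ^ 2 ∂mu ≤
          ENNReal.ofReal (2 * C₁ + 2 * M ^ 2) *
            ∫⁻ z, (‖deriv (fun x => p.eval x) z‖₊ : ℝ≥0∞) ^ 2 ∂mu := by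
      intro p hp
      obtain ⟨hA, hB⟩ := poly_facts hg hh hgD hφ hM p
      have hT := (H p hp).2
      have hAd : DifferentiableOn ℂ (fun z => deriv g z * p.eval z) (ball (0 : ℂ) 1) :=
        hg'.mul p.differentiable.differentiableOn
      have e : ∫⁻ z, (‖p.eval z‖₊ : ℝ≥0∞) ^ 2 * (‖deriv g z‖₊ : ℝ≥0∞) ^ 2 ∂mu =
          ∫⁻ z, (‖deriv (toeplitz g φ (fun z => p.eval z)) z +
            -deriv (TT (fun z => φ z * deriv (fun x => p.eval x) z)) z‖₊ : ℝ≥0∞) ^ 2 ∂mu := by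
        refine lintegral_congr_ae (ae_mu fun z hz => ?_)
        have h1 := TT_add_deriv (hA.integrable one_le_two) (hB.integrable one_le_two) hz
        rw [TT_repr hAd (hA.integrable one_le_two) hz] at h1
        change deriv (toeplitz g φ (fun z => p.eval z)) z = _ at h1
        simp only
        rw [h1, add_neg_cancel_right, nnnorm_mul, ENNReal.coe_mul, mul_pow, mul_comm]
      rw [e]
      refine (lint_add_le (measurable_deriv _).aemeasurable).trans ?_
      simp only [nnnorm_neg]
      rw [← const_combine hC₁.le (sq_nonneg M)]
      have hB2 := (TT_deriv_le hB).trans (lint_mul_le hM)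
      gcongr
    obtain ⟨p, hp0, hplim, hpD⟩ := approx hf hf0 hfD
    refine fatou (F := fun N z => (p N).eval z) (fun N => (p N).continuous) hgm hplim fun N => ?_
    refine (hpoly (p N) (hp0 N)).trans ?_
    exact mul_le_mul_right (hpD N) _
  · rintro ⟨C, hC, H⟩
    refine ⟨2 * C + 2 * M ^ 2, by positivity, fun f hf0 => ?_⟩
    obtain ⟨hA, hB⟩ := poly_facts hg hh hgD hφ hM f
    have hu := hA.add hB
    refine ⟨fun w hw => ((TT_deriv_aux (hu.integrable one_le_two) hw).1).differentiableWithinAt, ?_⟩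
    refine (TT_deriv_le hu).trans ?_
    refine (lint_add_le hA.aestronglyMeasurable.aemeasurable).trans ?_
    rw [← const_combine hC.le (sq_nonneg M)]
    have hfin : (∫⁻ z in ball (0 : ℂ) 1, (‖deriv (fun x => f.eval x) z‖₊ : ℝ≥0∞) ^ 2 ∂dA) < ⊤ := by
      have hfd : Continuous (deriv (fun x => f.eval x)) := by
        have : deriv (fun x => f.eval x) = fun x => f.derivative.eval x := by
          ext x; exact f.deriv
        rw [this]; exact f.derivative.continuous
      have := (integrable_of_cont hfd 2).2
      change ∫⁻ z, _ ∂mu < ⊤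
      rw [lint_eq]
      exact ENNReal.pow_lt_top this
    have h1 := H (fun x => f.eval x) f.differentiable.differentiableOn hf0 hfin
    have h2 : ∫⁻ z, (‖deriv g z * f.eval z‖₊ : ℝ≥0∞) ^ 2 ∂mu ≤ ENNReal.ofReal C *
        ∫⁻ z in ball (0 : ℂ) 1, (‖deriv (fun x => f.eval x) z‖₊ : ℝ≥0∞) ^ 2 ∂dA := by
      refine le_trans (le_of_eq (lintegral_congr fun z => ?_)) h1
      rw [nnnorm_mul, ENNReal.coe_mul, mul_pow, mul_comm]
    exact add_le_add (mul_le_mul_right h2 2) (mul_le_mul_right (lint_mul_le hM) 2)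
end

section
/- Let c : ℤ → ℂ be such that the power series g(z) = Σ_{k≥0} c(k) z^k and h(z) = Σ_{k≥1} conj(c(−k)) z^k converge for every z ∈ 𝔻, the function φ := g + conj∘h is bounded on 𝔻, and Σ_{k≥1} k·|c(k)|² < ∞. Then for every integer n ≥ 1 one has Σ_{k≥1} k·|c(k−n)|² < ∞, and for every w ∈ 𝔻, (T_φ(z ↦ zⁿ))(w) = ∫_𝔻 (g′(z)·zⁿ + n·z^{n−1}·φ(z)) · (w/(1 − w·conj(z))) dA(z) = Σ_{k≥1} c(k−n)·w^k. (Hence the matrix of T_φ in the orthogonal basis {zⁿ : n ≥ 1} of 𝒟₀ is the Toeplitz matrix (φ̂(i−j))_{i,j≥1}.) -/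
open MeasureTheory Metric
open scoped ENNReal ComplexConjugate

instance dA_fin : IsFiniteMeasureOnCompacts dA := by
  unfold dA
  exact IsFiniteMeasureOnCompacts.smul _ ENNReal.ofReal_ne_top

lemma ang_int (p q : ℕ) :
    ∫ t in Set.Ioo (-Real.pi) Real.pi, Complex.exp (((p : ℂ) - q) * Complex.I * (t : ℂ))
      = if p = q then 2 * (Real.pi : ℂ) else 0 := by
  have hpi : -Real.pi ≤ Real.pi := by linarith [Real.pi_pos]
  rw [← integral_Ioc_eq_integral_Ioo, ← intervalIntegral.integral_of_le hpi]
  split_ifs with h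
  · subst h
    simp
    ring
  · have hc : ((p : ℂ) - q) * Complex.I ≠ 0 := by
      refine mul_ne_zero ?_ Complex.I_ne_zero
      rw [sub_ne_zero]
      exact_mod_cast h
    rw [integral_exp_mul_complex hc]
    have : Complex.exp (((p : ℂ) - q) * Complex.I * (Real.pi : ℝ))
        = Complex.exp (((p : ℂ) - q) * Complex.I * ((-Real.pi : ℝ) : ℂ)) := by
      rw [Complex.exp_eq_exp_iff_exists_int]
      refine ⟨(p : ℤ) - q, ?_⟩
      push_cast
      ring
    rw [this]; simp

lemma mom (r : ℝ) (hr : 0 < r) (p q : ℕ) :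
    ∫ z in ball (0 : ℂ) r, z ^ p * conj z ^ q ∂dA
      = if p = q then ((r : ℂ) ^ (2 * p + 2)) / ((p : ℂ) + 1) else 0 := by
  have h0 : ∫ z in ball (0 : ℂ) r, z ^ p * conj z ^ q
      = ((r : ℂ) ^ (p + q + 2) / ((p : ℂ) + q + 2)) *
        (if p = q then 2 * (Real.pi : ℂ) else 0) := by
    rw [← integral_indicator measurableSet_ball, ← Complex.integral_comp_polarCoord_symm]
    rw [← ang_int p q]
    have hrad : ∫ x in Set.Ioi (0 : ℝ), (Set.Iio r).indicator (fun x : ℝ => (x : ℂ) ^ (p + q + 1)) x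
        = (r : ℂ) ^ (p + q + 2) / ((p : ℂ) + q + 2) := by
      rw [setIntegral_indicator measurableSet_Iio, Set.Ioi_inter_Iio,
        ← integral_Ioc_eq_integral_Ioo, ← intervalIntegral.integral_of_le hr.le]
      have := @integral_pow 0 r (p + q + 1)
      have h2 := congrArg (fun x : ℝ => (x : ℂ)) this
      simp only [← intervalIntegral.integral_ofReal] at h2
      push_cast at h2
      rw [h2]
      simp
      ring
    rw [← hrad, ← setIntegral_prod_mul, polarCoord_target]
    refine setIntegral_congr_fun (measurableSet_Ioi.prod measurableSet_Ioo) ?_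
    rintro ⟨x, t⟩ ⟨hx, ht⟩
    have hx' : 0 < x := hx
    have hz : (Complex.polarCoord.symm (x, t)) = (x : ℂ) * Complex.exp (t * Complex.I) := by
      rw [Complex.polarCoord_symm_apply, Complex.exp_mul_I]; simp
    have hn : ‖(x : ℂ) * Complex.exp (t * Complex.I)‖ = x := by
      rw [norm_mul, Complex.norm_exp_ofReal_mul_I, Complex.norm_real, Real.norm_of_nonneg hx'.le,
        mul_one]
    simp only [hz]
    by_cases hxr : x < r
    · rw [Set.indicator_of_mem (by simpa [hn, abs_of_pos hx'] using hxr : _ ∈ ball (0 : ℂ) r),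
        Set.indicator_of_mem (by exact hxr)]
      have hc : conj (Complex.exp (t * Complex.I)) = Complex.exp (-(t * Complex.I)) := by
        rw [← Complex.exp_conj]; simp
      have hE : Complex.exp (((p : ℂ) - q) * Complex.I * (t : ℂ))
          = Complex.exp (t * Complex.I) ^ p * Complex.exp (-(t * Complex.I)) ^ q := by
        rw [← Complex.exp_nat_mul, ← Complex.exp_nat_mul, ← Complex.exp_add]
        congr 1; ring
      rw [hE, map_mul, hc, Complex.conj_ofReal, Complex.real_smul]
      ring
    · rw [Set.indicator_of_notMem (by simpa [hn, abs_of_pos hx'] using hxr),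
        Set.indicator_of_notMem (by exact hxr)]
      simp
  rw [dA, Measure.restrict_smul, integral_smul_measure, h0,
    ENNReal.toReal_ofReal (by positivity)]
  split_ifs with h
  · subst h
    have : (Real.pi : ℂ) ≠ 0 := by exact_mod_cast Real.pi_ne_zero
    have h1 : (p : ℂ) + 1 ≠ 0 := by exact_mod_cast Nat.succ_ne_zero p
    have h2 : (p : ℂ) + p + 2 ≠ 0 := by
      intro h; apply h1; linear_combination h / 2
    rw [Complex.real_smul]
    have h3 : (p : ℂ) + p + 2 = 2 * (p + 1) := by ring
    rw [h3]
    push_cast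
    field_simp
    ring
  · simp

lemma series_int (r : ℝ) (hr : 0 < r) (a : ℕ → ℂ) (p q : ℕ → ℕ)
    (hs : Summable fun k => ‖a k‖ * r ^ (p k + q k)) :
    ∫ z in ball (0 : ℂ) r, ∑' k, a k * (z ^ p k * conj z ^ q k) ∂dA
      = ∑' k, a k * (if p k = q k then ((r : ℂ) ^ (2 * p k + 2)) / ((p k : ℂ) + 1) else 0) := by
  have hfin : dA (ball (0 : ℂ) r) < ⊤ := measure_ball_lt_top
  have hint : ∀ k, Integrable (fun z => a k * (z ^ p k * conj z ^ q k))
      (dA.restrict (ball (0 : ℂ) r)) := by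
    intro k
    have : Continuous (fun z : ℂ => a k * (z ^ p k * conj z ^ q k)) := by fun_prop
    exact (this.continuousOn.integrableOn_compact (isCompact_closedBall (0 : ℂ) r)).mono_set
      ball_subset_closedBall
  have := hasSum_integral_of_summable_integral_norm hint ?_
  · rw [← this.tsum_eq]
    congr 1; ext k
    rw [integral_const_mul, mom r hr]
  · refine Summable.of_nonneg_of_le (fun k => integral_nonneg fun z => norm_nonneg _) ?_
      (hs.mul_right (dA.real (ball (0 : ℂ) r)))
    intro k
    have hb := norm_setIntegral_le_of_norm_le_const (μ := dA)
      (f := fun z : ℂ => ‖a k * (z ^ p k * conj z ^ q k)‖) (C := ‖a k‖ * r ^ (p k + q k))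
      hfin ?_
    · exact (le_abs_self _).trans hb
    · intro z hz
      have hz' : ‖z‖ ≤ r := by simpa using (mem_ball.1 hz).le
      rw [norm_norm, norm_mul, norm_mul, norm_pow, norm_pow, RCLike.norm_conj, ← pow_add]
      gcongr

lemma ps_norm (a : ℕ → ℂ) (e : ℕ → ℕ)
    (hs : ∀ z ∈ ball (0 : ℂ) 1, Summable fun k => a k * z ^ e k) (r : ℝ) (hr : 0 ≤ r)
    (hr1 : r < 1) : Summable fun k => ‖a k‖ * r ^ e k := by
  have := (hs (r : ℂ) (by simpa [abs_of_nonneg hr] using hr1)).norm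
  simpa [abs_of_nonneg hr] using this

lemma ps_diff (a : ℕ → ℂ) (e : ℕ → ℕ)
    (hs : ∀ z ∈ ball (0 : ℂ) 1, Summable fun k => a k * z ^ e k) :
    DifferentiableOn ℂ (fun z => ∑' k, a k * z ^ e k) (ball 0 1) ∧
    ∀ z ∈ ball (0 : ℂ) 1, HasSum (fun k => a k * ((e k : ℂ) * z ^ (e k - 1)))
      (deriv (fun z => ∑' k, a k * z ^ e k) z) := by
  have key : ∀ z ∈ ball (0 : ℂ) 1, ∃ r : ℝ, z ∈ ball (0 : ℂ) r ∧ 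
      (Summable fun k => ‖a k‖ * r ^ e k) ∧
      (∀ k, ∀ w ∈ ball (0 : ℂ) r, ‖a k * w ^ e k‖ ≤ ‖a k‖ * r ^ e k) := by
    intro z hz
    have hz' : ‖z‖ < 1 := by simpa using hz
    obtain ⟨r, h1, h2⟩ := exists_between hz'
    refine ⟨r, by simpa using h1, ps_norm a e hs r ((norm_nonneg z).trans h1.le) h2, ?_⟩
    intro k w hw
    have : ‖w‖ ≤ r := by simpa using (mem_ball.1 hw).le
    rw [norm_mul, norm_pow]
    gcongr
  have hd : ∀ r : ℝ, ∀ k, DifferentiableOn ℂ (fun z : ℂ => a k * z ^ e k) (ball (0 : ℂ) r) := by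
    intro r k
    fun_prop
  constructor
  · intro z hz
    obtain ⟨r, h1, h2, h3⟩ := key z hz
    exact ((Complex.differentiableOn_tsum_of_summable_norm h2 (hd r) isOpen_ball h3).differentiableAt
      (isOpen_ball.mem_nhds h1)).differentiableWithinAt
  · intro z hz
    obtain ⟨r, h1, h2, h3⟩ := key z hz
    have := Complex.hasSum_deriv_of_summable_norm h2 (hd r) isOpen_ball h3 h1
    have hh : (fun k => deriv (fun z : ℂ => a k * z ^ e k) z)
        = fun k => a k * ((e k : ℂ) * z ^ (e k - 1)) := by
      ext k; simp
    rwa [hh] at this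

lemma poly_L2 (a : ℕ → ℂ) (N : ℕ) :
    ∫⁻ z in ball (0 : ℂ) 1, ‖∑ k ∈ Finset.range N, a k * z ^ k‖ₑ ^ 2 ∂dA
      = ENNReal.ofReal (∑ k ∈ Finset.range N, ‖a k‖ ^ 2 / ((k : ℝ) + 1)) := by
  have hi : ∀ f : ℂ → ℂ, Continuous f → IntegrableOn f (ball (0 : ℂ) 1) dA := fun f hf =>
    (hf.continuousOn.integrableOn_compact (isCompact_closedBall (0 : ℂ) 1)).mono_set
      ball_subset_closedBall
  have hc : ∫ z in ball (0 : ℂ) 1, ((‖∑ k ∈ Finset.range N, a k * z ^ k‖ ^ 2 : ℝ) : ℂ) ∂dA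
      = ((∑ k ∈ Finset.range N, ‖a k‖ ^ 2 / ((k : ℝ) + 1) : ℝ) : ℂ) := by
    have : ∀ z : ℂ, ((‖∑ k ∈ Finset.range N, a k * z ^ k‖ ^ 2 : ℝ) : ℂ)
        = ∑ j ∈ Finset.range N, ∑ k ∈ Finset.range N, (a j * conj (a k)) * (z ^ j * conj z ^ k) := by
      intro z
      push_cast
      rw [← Complex.mul_conj', map_sum, Finset.sum_mul_sum]
      refine Finset.sum_congr rfl fun j _ => Finset.sum_congr rfl fun k _ => ?_
      rw [map_mul, map_pow]; ring
    simp_rw [this]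
    rw [integral_finsetSum _ (fun j _ => hi _ (by fun_prop))]
    push_cast
    refine Finset.sum_congr rfl fun j hj => ?_
    rw [integral_finsetSum _ (fun j _ => hi _ (by fun_prop))]
    simp_rw [integral_const_mul, mom 1 one_pos]
    rw [Finset.sum_eq_single j]
    · rw [Complex.mul_conj']; simp; ring
    · intro k _ hk
      rw [if_neg (Ne.symm hk), mul_zero]
    · intro h; exact absurd hj h
  rw [integral_complex_ofReal] at hc
  have hc' : ∫ z in ball (0 : ℂ) 1, ‖∑ k ∈ Finset.range N, a k * z ^ k‖ ^ 2 ∂dA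
      = ∑ k ∈ Finset.range N, ‖a k‖ ^ 2 / ((k : ℝ) + 1) := by exact_mod_cast hc
  have hcont : Continuous (fun z : ℂ => ‖∑ k ∈ Finset.range N, a k * z ^ k‖ ^ 2) := by fun_prop
  rw [← hc', ofReal_integral_eq_lintegral_ofReal]
  · refine lintegral_congr fun z => ?_
    rw [ENNReal.ofReal_pow (norm_nonneg _), ofReal_norm]
  · exact (hcont.continuousOn.integrableOn_compact (isCompact_closedBall (0 : ℂ) 1)).mono_set
      ball_subset_closedBall
  · exact Filter.Eventually.of_forall fun z => by positivity

lemma L2_int (a : ℕ → ℂ) (f : ℂ → ℂ) (hf : Measurable f)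
    (hs : ∀ z ∈ ball (0 : ℂ) 1, HasSum (fun k => a k * z ^ k) (f z))
    (hsum : Summable fun k : ℕ => ‖a k‖ ^ 2 / ((k : ℝ) + 1)) :
    IntegrableOn f (ball (0 : ℂ) 1) dA := by
  have : IsFiniteMeasure (dA.restrict (ball (0 : ℂ) 1)) :=
    ⟨by rw [Measure.restrict_apply_univ]; exact measure_ball_lt_top⟩
  have h1 : ∫⁻ z in ball (0 : ℂ) 1, ‖f z‖ₑ ^ 2 ∂dA
      ≤ ENNReal.ofReal (∑' k : ℕ, ‖a k‖ ^ 2 / ((k : ℝ) + 1)) := by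
    have e : ∫⁻ z in ball (0 : ℂ) 1, ‖f z‖ₑ ^ 2 ∂dA = ∫⁻ z in ball (0 : ℂ) 1,
        Filter.liminf (fun N => ‖∑ k ∈ Finset.range N, a k * z ^ k‖ₑ ^ 2) Filter.atTop ∂dA := by
      refine setLIntegral_congr_fun measurableSet_ball fun z hz => ?_
      have ht := (hs z hz).tendsto_sum_nat
      exact ((ENNReal.continuous_pow 2).tendsto _ |>.comp ht.enorm).liminf_eq.symm
    rw [e]
    refine (lintegral_liminf_le fun N => ?_).trans ?_
    · have : Continuous (fun z : ℂ => ∑ k ∈ Finset.range N, a k * z ^ k) := by fun_prop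
      exact this.measurable.enorm.pow_const 2
    · simp_rw [poly_L2]
      refine (Filter.liminf_le_liminf (v := fun _ => ENNReal.ofReal (∑' k : ℕ, ‖a k‖ ^ 2 / ((k : ℝ) + 1))) (Filter.Eventually.of_forall fun N => ?_)).trans ?_
      · exact ENNReal.ofReal_le_ofReal (hsum.sum_le_tsum _ fun k _ => by positivity)
      · simp
  have h2 : MemLp f 2 (dA.restrict (ball (0 : ℂ) 1)) := by
    refine ⟨hf.aestronglyMeasurable, ?_⟩
    rw [eLpNorm_lt_top_iff_lintegral_rpow_enorm_lt_top (by norm_num) (by norm_num)]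
    simpa using h1.trans_lt ENNReal.ofReal_lt_top
  exact h2.integrable (by norm_num)

lemma coef (c : ℤ → ℂ) (g h φ : ℂ → ℂ)
    (hgdef : ∀ z : ℂ, g z = ∑' k : ℕ, c k * z ^ k)
    (hhdef : ∀ z : ℂ, h z = ∑' k : ℕ, conj (c (-(k : ℤ) - 1)) * z ^ (k + 1))
    (hgconv : ∀ z ∈ ball (0 : ℂ) 1, Summable (fun k : ℕ => c k * z ^ k))
    (hhconv : ∀ z ∈ ball (0 : ℂ) 1,
      Summable (fun k : ℕ => conj (c (-(k : ℤ) - 1)) * z ^ (k + 1)))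
    (hφ : ∀ z, φ z = g z + conj (h z)) (n m : ℕ) (hn : 1 ≤ n) (r : ℝ) (hr : 0 < r) (hr1 : r < 1) :
    ∫ z in ball (0 : ℂ) r, (deriv g z * z ^ n + (n : ℂ) * z ^ (n - 1) * φ z) * conj z ^ m ∂dA
      = c ((m : ℤ) + 1 - n) * (r : ℂ) ^ (2 * max (m + 1) n) := by
  have hsub : closedBall (0 : ℂ) r ⊆ ball 0 1 := closedBall_subset_ball hr1
  have hg' : g = fun z => ∑' k : ℕ, c k * z ^ k := funext hgdef
  have hh' : h = fun z => ∑' k : ℕ, conj (c (-(k : ℤ) - 1)) * z ^ (k + 1) := funext hhdef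
  obtain ⟨hgd, hgs⟩ := ps_diff (fun k => c k) (fun k => k) hgconv
  obtain ⟨hhd, -⟩ := ps_diff (fun k => conj (c (-(k : ℤ) - 1))) (fun k => k + 1) hhconv
  simp only [← hg'] at hgd hgs
  simp only [← hh'] at hhd
  have cg : ContinuousOn g (closedBall 0 r) := hgd.continuousOn.mono hsub
  have ch : ContinuousOn h (closedBall 0 r) := hhd.continuousOn.mono hsub
  have cdg : ContinuousOn (deriv g) (closedBall 0 r) :=
    (hgd.deriv isOpen_ball).continuousOn.mono hsub
  have cconj : Continuous (fun z : ℂ => conj z) := Complex.continuous_conj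
  have i1 : IntegrableOn (fun z => (deriv g z * z ^ n + (n : ℂ) * z ^ (n - 1) * g z) * conj z ^ m)
      (ball 0 r) dA := by
    refine (ContinuousOn.integrableOn_compact (isCompact_closedBall (0 : ℂ) r) ?_).mono_set
      ball_subset_closedBall
    fun_prop
  have i2 : IntegrableOn (fun z => ((n : ℂ) * z ^ (n - 1) * conj (h z)) * conj z ^ m)
      (ball 0 r) dA := by
    refine (ContinuousOn.integrableOn_compact (isCompact_closedBall (0 : ℂ) r) ?_).mono_set
      ball_subset_closedBall
    have : ContinuousOn (fun z => conj (h z)) (closedBall 0 r) := cconj.comp_continuousOn ch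
    fun_prop
  have e0 : ∀ z, (deriv g z * z ^ n + (n : ℂ) * z ^ (n - 1) * φ z) * conj z ^ m
      = (deriv g z * z ^ n + (n : ℂ) * z ^ (n - 1) * g z) * conj z ^ m
        + ((n : ℂ) * z ^ (n - 1) * conj (h z)) * conj z ^ m := by
    intro z; rw [hφ]; ring
  have hA : ∀ z ∈ ball (0 : ℂ) 1, HasSum
      (fun k : ℕ => (((k : ℂ) + n) * c k) * (z ^ (k + n - 1) * conj z ^ m))
      ((deriv g z * z ^ n + (n : ℂ) * z ^ (n - 1) * g z) * conj z ^ m) := by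
    intro z hz
    have h1 := (hgs z hz).mul_right (z ^ n)
    have h2 := (hgconv z hz).hasSum.mul_left ((n : ℂ) * z ^ (n - 1))
    rw [← hgdef] at h2
    have h3 := (h1.add h2).mul_right (conj z ^ m)
    suffices hfe : (fun k : ℕ => (((k : ℂ) + n) * c k) * (z ^ (k + n - 1) * conj z ^ m))
        = fun k : ℕ => (c k * ((k : ℂ) * z ^ (k - 1)) * z ^ n
          + (n : ℂ) * z ^ (n - 1) * (c k * z ^ k)) * conj z ^ m by
      rw [hfe]; exact h3
    funext k
    obtain ⟨j, rfl⟩ := Nat.exists_eq_add_of_le' hn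
    rcases k with _ | k
    · simp; ring
    · have : k + 1 + (j + 1) - 1 = k + 1 + j := by omega
      simp only [this, Nat.add_sub_cancel]
      push_cast
      ring
  have e1 : ∫ z in ball (0 : ℂ) r,
      (deriv g z * z ^ n + (n : ℂ) * z ^ (n - 1) * g z) * conj z ^ m ∂dA
      = ∫ z in ball (0 : ℂ) r, ∑' k : ℕ,
        (((k : ℂ) + n) * c k) * (z ^ (k + n - 1) * conj z ^ m) ∂dA :=
    setIntegral_congr_fun measurableSet_ball fun z hz =>
      ((hA z (hsub (ball_subset_closedBall hz))).tsum_eq).symm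
  have e2 : ∫ z in ball (0 : ℂ) r, ((n : ℂ) * z ^ (n - 1) * conj (h z)) * conj z ^ m ∂dA
      = ∫ z in ball (0 : ℂ) r, ∑' k : ℕ,
        ((n : ℂ) * c (-(k : ℤ) - 1)) * (z ^ (n - 1) * conj z ^ (k + 1 + m)) ∂dA := by
    refine integral_congr_ae (Filter.Eventually.of_forall fun z => ?_)
    simp only
    rw [hhdef, Complex.conj_tsum, ← tsum_mul_left, ← tsum_mul_right]
    refine tsum_congr fun k => ?_
    simp only [map_mul, map_pow, Complex.conj_conj]
    ring
  simp_rw [e0]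
  rw [integral_add i1 i2, e1, e2]
  have hrm : (r : ℂ) ∈ ball (0 : ℂ) 1 := by simpa [abs_of_pos hr] using hr1
  rw [series_int r hr _ (fun k => k + n - 1) (fun _ => m), series_int r hr _ (fun _ => n - 1) (fun k => k + 1 + m)]
  · rcases le_or_gt n (m + 1) with hnm | hnm
    · obtain ⟨d, hd⟩ := Nat.exists_eq_add_of_le hnm
      have hz : ∀ k : ℕ, n - 1 ≠ k + 1 + m := fun k => by omega
      rw [tsum_eq_single d]
      · have h1 : d + n - 1 = m := by omega
        have h2 : (m : ℤ) + 1 - n = d := by omega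
        have h3 : max (m + 1) n = m + 1 := by omega
        have h4 : (m : ℂ) + 1 = (d : ℂ) + n := by
          have : m + 1 = d + n := by omega
          exact_mod_cast this
        have h5 : (d : ℂ) + n ≠ 0 := by
          have : d + n ≠ 0 := by omega
          exact_mod_cast this
        simp only [hz, if_false, mul_zero, tsum_zero, add_zero, h1, if_true, h2, h3, h4]
        field_simp
        ring
      · intro k hk
        rw [if_neg (by omega), mul_zero]
    · obtain ⟨d, hd⟩ := Nat.exists_eq_add_of_lt hnm
      have hz : ∀ k : ℕ, k + n - 1 ≠ m := fun k => by omega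
      rw [tsum_eq_single (L := SummationFilter.unconditional ℕ) (f := fun k : ℕ => (n : ℂ) * c (-(k : ℤ) - 1) *
        (if n - 1 = k + 1 + m then (r : ℂ) ^ (2 * (n - 1) + 2) / (((n - 1 : ℕ) : ℂ) + 1) else 0)) d]
      · have h1 : n - 1 = d + 1 + m := by omega
        have h2 : (m : ℤ) + 1 - n = -(d : ℤ) - 1 := by omega
        have h3 : 2 * max (m + 1) n = 2 * (n - 1) + 2 := by omega
        have h4 : ((n - 1 : ℕ) : ℂ) + 1 = n := by
          have : n - 1 + 1 = n := by omega
          exact_mod_cast this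
        have h5 : (n : ℂ) ≠ 0 := by
          have : n ≠ 0 := by omega
          exact_mod_cast this
        simp only [hz, if_false, mul_zero, tsum_zero, zero_add, if_pos h1, h2, h3, h4]
        field_simp
      · intro k hk
        rw [if_neg (by omega), mul_zero]
  · have := (ps_norm _ _ hhconv r hr.le hr1).mul_left ((n : ℝ) * r ^ (n - 1 + m))
    refine this.congr fun k => ?_
    simp only [norm_mul, RCLike.norm_conj, Complex.norm_natCast]
    ring
  · have := (hA r hrm).summable.norm
    refine this.congr fun k => ?_
    rw [Complex.conj_ofReal, ← pow_add, norm_mul, norm_pow, Complex.norm_real,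
      Real.norm_of_nonneg hr.le]

theorem statement1 (c : ℤ → ℂ) (g h φ : ℂ → ℂ)
    (hgdef : ∀ z : ℂ, g z = ∑' k : ℕ, c k * z ^ k)
    (hhdef : ∀ z : ℂ, h z = ∑' k : ℕ, conj (c (-(k : ℤ) - 1)) * z ^ (k + 1))
    (hgconv : ∀ z ∈ ball (0 : ℂ) 1, Summable (fun k : ℕ => c k * z ^ k))
    (hhconv : ∀ z ∈ ball (0 : ℂ) 1,
      Summable (fun k : ℕ => conj (c (-(k : ℤ) - 1)) * z ^ (k + 1)))
    (hφ : ∀ z, φ z = g z + conj (h z))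
    (hbdd : ∃ M : ℝ, ∀ z ∈ ball (0 : ℂ) 1, ‖φ z‖ ≤ M)
    (hD : Summable (fun k : ℕ => (k : ℝ) * ‖c k‖ ^ 2)) :
    ∀ n : ℕ, 1 ≤ n →
      Summable (fun k : ℕ => ((k : ℝ) + 1) * ‖c ((k : ℤ) + 1 - n)‖ ^ 2) ∧
      ∀ w ∈ ball (0 : ℂ) 1,
        (∫ z in ball (0 : ℂ) 1,
            (deriv g z * z ^ n + (n : ℂ) * z ^ (n - 1) * φ z) * (w / (1 - w * conj z)) ∂dA)
          = ∑' k : ℕ, c ((k : ℤ) + 1 - n) * w ^ (k + 1) := by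
  intro n hn
  have hg' : g = fun z => ∑' k : ℕ, c k * z ^ k := funext hgdef
  have hh' : h = fun z => ∑' k : ℕ, conj (c (-(k : ℤ) - 1)) * z ^ (k + 1) := funext hhdef
  constructor
  · obtain ⟨j, rfl⟩ := Nat.exists_eq_add_of_le' hn
    rw [← summable_nat_add_iff (j + 1)]
    have hD1 := (summable_nat_add_iff 1).mpr hD
    refine Summable.of_nonneg_of_le (fun k => by positivity) (fun k => ?_)
      (hD1.mul_left ((j : ℝ) + 2))
    have : ((k + (j + 1) : ℕ) : ℤ) + 1 - ((j + 1 : ℕ) : ℤ) = ((k + 1 : ℕ) : ℤ) := by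
      push_cast; ring
    rw [this, ← mul_assoc]
    refine mul_le_mul_of_nonneg_right ?_ (by positivity)
    push_cast
    have : 0 ≤ (k : ℝ) * j := by positivity
    nlinarith [Nat.cast_nonneg (α := ℝ) k]
  intro w hw
  have hw' : ‖w‖ < 1 := by simpa using hw
  obtain ⟨M, hM⟩ := hbdd
  have hfin : dA (ball (0 : ℂ) 1) < ⊤ := measure_ball_lt_top
  obtain ⟨hgd, hgs⟩ := ps_diff (fun k => c k) (fun k => k) hgconv
  obtain ⟨hhd, -⟩ := ps_diff (fun k => conj (c (-(k : ℤ) - 1))) (fun k => k + 1) hhconv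
  simp only [← hg'] at hgd hgs
  simp only [← hh'] at hhd
  have hcφ : ContinuousOn φ (ball 0 1) := by
    have : ContinuousOn (fun z => g z + conj (h z)) (ball 0 1) :=
      hgd.continuousOn.add (Complex.continuous_conj.comp_continuousOn hhd.continuousOn)
    rwa [← funext hφ] at this
  have iφ : IntegrableOn (fun z => (n : ℂ) * z ^ (n - 1) * φ z) (ball 0 1) dA := by
    have : IsFiniteMeasure (dA.restrict (ball (0 : ℂ) 1)) :=
      ⟨by rw [Measure.restrict_apply_univ]; exact hfin⟩
    refine Integrable.of_bound ?_ ((n : ℝ) * M) ?_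
    · refine ContinuousOn.aestronglyMeasurable (s := ball (0 : ℂ) 1) ?_ measurableSet_ball
      fun_prop
    · refine (ae_restrict_iff' (measurableSet_ball (x := (0 : ℂ)) (ε := 1))).mpr
        (Filter.Eventually.of_forall fun z hz => ?_)
      have hz' : ‖z‖ ≤ 1 := by simpa using (mem_ball.1 hz).le
      rw [norm_mul, norm_mul, norm_pow, Complex.norm_natCast]
      have h1 := hM z hz
      have h2 : ‖z‖ ^ (n - 1) ≤ 1 := pow_le_one₀ (norm_nonneg _) hz'
      have h3 : (n : ℝ) * ‖z‖ ^ (n - 1) ≤ n := mul_le_of_le_one_right (by positivity) h2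
      exact mul_le_mul h3 h1 (norm_nonneg _) (by positivity)
  have idg : IntegrableOn (deriv g) (ball 0 1) dA := by
    refine L2_int (fun k => c ((k + 1 : ℕ) : ℤ) * ((k + 1 : ℕ) : ℂ)) _ (measurable_deriv g) ?_ ?_
    · intro z hz
      have := hgs z hz
      rw [← hasSum_nat_add_iff' 1] at this
      simpa [mul_assoc] using this
    · have hD1 := (summable_nat_add_iff 1).mpr hD
      refine hD1.congr fun k => ?_
      have : (k : ℝ) + 1 ≠ 0 := by positivity
      rw [norm_mul, Complex.norm_natCast]
      push_cast
      field_simp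
  have bdd : ∀ (f : ℂ → ℂ) (F : ℂ → ℂ), IntegrableOn F (ball 0 1) dA → Continuous f →
      (∀ z ∈ ball (0 : ℂ) 1, ‖f z‖ ≤ 1) → IntegrableOn (fun z => F z * f z) (ball 0 1) dA := by
    intro f F hF hf hb
    exact Integrable.mul_bdd (c := 1) hF hf.aestronglyMeasurable
      ((ae_restrict_iff' measurableSet_ball).mpr (Filter.Eventually.of_forall hb))
  have iF : IntegrableOn (fun z => deriv g z * z ^ n + (n : ℂ) * z ^ (n - 1) * φ z)
      (ball 0 1) dA := by
    refine Integrable.add (bdd _ _ idg (by fun_prop) fun z hz => ?_) iφ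
    have hz' : ‖z‖ ≤ 1 := by simpa using (mem_ball.1 hz).le
    rw [norm_pow]
    exact pow_le_one₀ (norm_nonneg _) hz'
  set F : ℂ → ℂ := fun z => deriv g z * z ^ n + (n : ℂ) * z ^ (n - 1) * φ z with hF
  have hpw : ∀ (m : ℕ) (z : ℂ), z ∈ ball (0 : ℂ) 1 → ‖conj z ^ m‖ ≤ 1 := by
    intro m z hz
    have hz' : ‖z‖ ≤ 1 := by simpa using (mem_ball.1 hz).le
    rw [norm_pow, RCLike.norm_conj]
    exact pow_le_one₀ (norm_nonneg _) hz'
  have iFm : ∀ m : ℕ, IntegrableOn (fun z => F z * conj z ^ m) (ball 0 1) dA := fun m =>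
    bdd _ _ iF (Complex.continuous_conj.pow m) (hpw m)
  have hcoef : ∀ m : ℕ, ∫ z in ball (0 : ℂ) 1, F z * conj z ^ m ∂dA = c ((m : ℤ) + 1 - n) := by
    intro m
    set r : ℕ → ℝ := fun i => 1 - 1 / ((i : ℝ) + 2) with hr
    have hrm : Monotone r := by
      intro i j hij
      simp only [hr]
      gcongr
    have hr0 : ∀ i, 0 < r i := by
      intro i
      have : 1 / ((i : ℝ) + 2) < 1 := by
        rw [div_lt_one (by positivity)]
        linarith [Nat.cast_nonneg (α := ℝ) i]
      simp only [hr]; linarith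
    have hr1 : ∀ i, r i < 1 := by
      intro i
      have : 0 < 1 / ((i : ℝ) + 2) := by positivity
      simp only [hr]; linarith
    have hrt : Filter.Tendsto r Filter.atTop (nhds 1) := by
      have h1 := (tendsto_one_div_add_atTop_nhds_zero_nat (𝕜 := ℝ)).comp
        (Filter.tendsto_add_atTop_nat 1)
      have h2 := h1.const_sub 1
      rw [sub_zero] at h2
      refine h2.congr fun i => ?_
      simp only [Function.comp, hr]
      push_cast
      ring
    have hU : ⋃ i, ball (0 : ℂ) (r i) = ball 0 1 := by
      ext z
      simp only [Set.mem_iUnion]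
      constructor
      · rintro ⟨i, hi⟩
        exact ball_subset_ball (hr1 i).le hi
      · intro hz
        have hz' : ‖z‖ < 1 := by simpa using hz
        obtain ⟨i, hi⟩ := (hrt.eventually (lt_mem_nhds hz')).exists
        exact ⟨i, by simpa using hi⟩
    have ht := tendsto_setIntegral_of_monotone (μ := dA) (f := fun z => F z * conj z ^ m)
      (s := fun i => ball (0 : ℂ) (r i)) (fun i => measurableSet_ball)
      (fun i j hij => ball_subset_ball (hrm hij)) (by rw [hU]; exact iFm m)
    rw [hU] at ht
    refine tendsto_nhds_unique ht ?_
    have hrc : Filter.Tendsto (fun i => ((r i : ℝ) : ℂ)) Filter.atTop (nhds 1) := by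
      have := (Complex.continuous_ofReal.tendsto 1).comp hrt
      rw [Complex.ofReal_one] at this
      exact this
    have h3 := (hrc.pow (2 * max (m + 1) n)).const_mul (c ((m : ℤ) + 1 - n))
    rw [one_pow, mul_one] at h3
    refine h3.congr fun i => ?_
    exact (coef c g h φ hgdef hhdef hgconv hhconv hφ n m hn (r i) (hr0 i) (hr1 i)).symm
  have e1 : ∫ z in ball (0 : ℂ) 1, F z * (w / (1 - w * conj z)) ∂dA
      = ∫ z in ball (0 : ℂ) 1, ∑' m : ℕ, w ^ (m + 1) * (F z * conj z ^ m) ∂dA := by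
    refine setIntegral_congr_fun measurableSet_ball fun z hz => ?_
    have hz' : ‖z‖ < 1 := by simpa using hz
    have hlt : ‖w * conj z‖ < 1 := by
      rw [norm_mul, RCLike.norm_conj]
      exact mul_lt_one_of_nonneg_of_lt_one_left (norm_nonneg _) hw' hz'.le
    have hgeo := (hasSum_geometric_of_norm_lt_one hlt).mul_left (F z * w)
    rw [div_eq_mul_inv, ← mul_assoc, ← hgeo.tsum_eq]
    refine tsum_congr fun m => ?_
    rw [mul_pow]; ring
  rw [e1]
  have := hasSum_integral_of_summable_integral_norm (μ := dA.restrict (ball (0 : ℂ) 1))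
    (F := fun (m : ℕ) z => w ^ (m + 1) * (F z * conj z ^ m)) (fun m => (iFm m).const_mul _) ?_
  · rw [← this.tsum_eq]
    refine tsum_congr fun m => ?_
    rw [integral_const_mul, hcoef, mul_comm]
  · refine Summable.of_nonneg_of_le (fun k => integral_nonneg fun z => norm_nonneg _) ?_
      (((summable_geometric_of_lt_one (norm_nonneg w) hw').mul_left ‖w‖).mul_right
        (∫ z in ball (0 : ℂ) 1, ‖F z‖ ∂dA))
    intro m
    rw [← integral_const_mul]
    refine setIntegral_mono_on ((iFm m).const_mul _).norm (iF.norm.const_mul _)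
      measurableSet_ball fun z hz => ?_
    rw [norm_mul, norm_mul, norm_pow, pow_succ']
    exact mul_le_mul_of_nonneg_left (mul_le_of_le_one_right (norm_nonneg _) (hpw m z hz))
      (by positivity)
end

section
/- Let T be a compact (bounded) operator on H that has Toeplitz matrix with coefficient sequence c : ℤ → ℂ. Then c(k) = 0 for all k ∈ ℤ and T = 0. (Thus a Toeplitz operator on the Dirichlet space with symbol in 𝒯(𝒟₀) is compact if and only if its symbol is 0.) -/
open scoped ComplexConjugate

local notation "⟪" x ", " y "⟫" => @inner ℂ _ _ x y

theorem statement3 {H : Type*} [NormedAddCommGroup H] [InnerProductSpace ℂ H]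
    [CompleteSpace H]
    -- `e n` (for `n ≥ 1`) is the coefficient model of `zⁿ` in the Dirichlet space:
    -- an orthogonal family with `‖e n‖² = n` whose span is dense.
    (e : ℕ → H)
    (horth : ∀ m n : ℕ, 1 ≤ m → 1 ≤ n → ⟪e m, e n⟫ = if m = n then (m : ℂ) else 0)
    (hdense : Dense (Submodule.span ℂ (e '' {n : ℕ | 1 ≤ n}) : Set H))
    -- `T` is a bounded operator whose matrix is the Toeplitz matrix with coefficients `c` :
    -- in the paper's convention `⟨T e_n, e_m⟩ = m · c (m − n)`.
    (T : H →L[ℂ] H) (c : ℤ → ℂ)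
    (hT : ∀ m n : ℕ, 1 ≤ m → 1 ≤ n → ⟪e m, T (e n)⟫ = (m : ℂ) * c ((m : ℤ) - n))
    -- `T` is compact
    (hcmp : IsCompactOperator (⇑T)) :
    (∀ k : ℤ, c k = 0) ∧ T = 0 := by
  have hc : ∀ k : ℤ, c k = 0 := by
    intro k
    obtain ⟨a, b, rfl⟩ : ∃ a b : ℕ, k = (a : ℤ) - b :=
      ⟨k.toNat, (-k).toNat, by omega⟩
    let r : ℕ → ℝ := fun n => Real.sqrt ((n : ℝ) + 1)
    have hr0 : ∀ n, 0 < r n := fun n => Real.sqrt_pos.2 (by positivity)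
    have hrsq : ∀ n, r n * r n = (n : ℝ) + 1 := fun n => Real.mul_self_sqrt (by positivity)
    have hrC : ∀ n, (r n : ℂ) ≠ 0 := fun n => by exact_mod_cast (hr0 n).ne'
    have hrsqC : ∀ n, (r n : ℂ) * r n = (n : ℂ) + 1 := fun n => by exact_mod_cast hrsq n
    let g : ℕ → H := fun n => ((r n : ℂ)⁻¹) • e (n + 1)
    have hgg : Orthonormal ℂ g := by
      rw [orthonormal_iff_ite]
      intro m n
      simp only [g, inner_smul_left, inner_smul_right, map_inv₀, Complex.conj_ofReal]
      rw [horth (m + 1) (n + 1) (by omega) (by omega)]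
      by_cases h : m = n
      · subst h
        have := hrC m
        simp only [if_true]
        push_cast
        rw [← hrsqC]
        field_simp
      · simp [h]
    have hgT : ∀ m n : ℕ, ⟪g m, T (g n)⟫ = (r m / r n : ℂ) * c ((m : ℤ) - n) := by
      intro m n
      simp only [g, map_smul, inner_smul_left, inner_smul_right, map_inv₀, Complex.conj_ofReal]
      rw [hT (m + 1) (n + 1) (by omega) (by omega)]
      have h1 := hrC m
      have h2 := hrC n
      have h3 : (((m + 1 : ℕ) : ℤ) - ((n + 1 : ℕ) : ℤ)) = (m : ℤ) - n := by push_cast; ring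
      rw [h3]
      push_cast
      rw [← hrsqC]
      field_simp
    obtain ⟨K, hK, hKs⟩ := IsCompactOperator.image_closedBall_subset_compact (f := (T : H →ₗ[ℂ] H)) hcmp 1
    have hmem : ∀ j : ℕ, T (g (j + b)) ∈ K := fun j =>
      hKs ⟨g (j + b), by simp [hgg.1 (j + b)], rfl⟩
    obtain ⟨y, -, φ, hφ, hlim⟩ := hK.tendsto_subseq hmem
    have hB : Filter.Tendsto (fun n => ‖⟪g n, y⟫‖ ^ 2) Filter.atTop (nhds 0) :=
      (hgg.inner_products_summable y).tendsto_atTop_zero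
    have hB' : Filter.Tendsto (fun n => ‖⟪g n, y⟫‖) Filter.atTop (nhds 0) := by
      have := hB.sqrt
      simpa using this
    have hsub : Filter.Tendsto (fun j => φ j + a) Filter.atTop Filter.atTop :=
      Filter.tendsto_atTop_mono (fun j => Nat.le_add_right _ _) hφ.tendsto_atTop
    have hB2 := hB'.comp hsub
    have hN : Filter.Tendsto (fun j => ‖T (g (φ j + b)) - y‖) Filter.atTop (nhds 0) :=
      tendsto_iff_norm_sub_tendsto_zero.1 hlim
    have hS := (hB2.add hN).const_mul ((b : ℝ) + 1)
    rw [add_zero, mul_zero] at hS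
    have hle : ‖c ((a : ℤ) - b)‖ ≤ 0 := by
      refine ge_of_tendsto' hS fun j => ?_
      have h1 := hgT (φ j + a) (φ j + b)
      have h3 : (((φ j + a : ℕ) : ℤ) - ((φ j + b : ℕ) : ℤ)) = (a : ℤ) - b := by push_cast; ring
      rw [h3] at h1
      have h2 : ‖⟪g (φ j + a), T (g (φ j + b))⟫‖ ≤ ‖⟪g (φ j + a), y⟫‖ + ‖T (g (φ j + b)) - y‖ := by
        have : T (g (φ j + b)) = y + (T (g (φ j + b)) - y) := by abel
        conv_lhs => rw [this, inner_add_right]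
        refine (norm_add_le _ _).trans (add_le_add le_rfl ?_)
        refine (norm_inner_le_norm _ _).trans ?_
        rw [hgg.1, one_mul]
      have h4 : r (φ j + b) ≤ ((b : ℝ) + 1) * r (φ j + a) := by
        apply Real.sqrt_le_iff.2
        refine ⟨by have := hr0 (φ j + a); positivity, ?_⟩
        have := hrsq (φ j + a)
        rw [mul_pow, pow_two (r _), this]
        push_cast
        have hb : (0 : ℝ) ≤ b := by positivity
        have ha : (0 : ℝ) ≤ a := by positivity
        have hj : (0 : ℝ) ≤ φ j := by positivity
        nlinarith [mul_nonneg hb ha, mul_nonneg hb hj, mul_nonneg (mul_nonneg hb hb) ha,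
          mul_nonneg (mul_nonneg hb hb) hj]
      have h5 : ‖c ((a : ℤ) - b)‖ ≤ ((b : ℝ) + 1) * ‖⟪g (φ j + a), T (g (φ j + b))⟫‖ := by
        rw [h1, norm_mul, norm_div, Complex.norm_real, Complex.norm_real,
          Real.norm_of_nonneg (hr0 _).le, Real.norm_of_nonneg (hr0 _).le, ← mul_assoc]
        apply le_mul_of_one_le_left (norm_nonneg _)
        rw [← mul_div_assoc, one_le_div (hr0 _)]
        exact h4
      exact h5.trans (mul_le_mul_of_nonneg_left h2 (by positivity))
    exact norm_le_zero_iff.1 hle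
  refine ⟨hc, ?_⟩
  refine ContinuousLinearMap.ext_on hdense ?_
  rintro _ ⟨n, hn, rfl⟩
  have hz : innerSL ℂ (T (e n)) = 0 := by
    refine ContinuousLinearMap.ext_on hdense ?_
    rintro _ ⟨m, hm, rfl⟩
    have h := hT m n hm hn
    rw [hc, mul_zero] at h
    simpa using inner_eq_zero_symm.1 h
  have := congrArg (fun L => L (T (e n))) hz
  simpa using this
end

section
/- Let τ : ℝ → B(H) be the family of unitary operators determined by τ(θ) e_n = exp(−i n θ)·e_n for all n ≥ 1 and θ ∈ ℝ, and let T be a bounded operator on H that has Toeplitz matrix with coefficient sequence c : ℤ → ℂ. Then for every k ∈ ℤ and every f ∈ H, the k-th homogeneous part T_k f := (1/2π)·∫₀^{2π} exp(−ikθ)·(τ(−θ)(T(τ(θ) f))) dθ (a Bochner integral in H) satisfies: T_k f = c(k)·(S^k f) if k ≥ 0, and T_k f = c(k)·(B^{|k|} f) if k < 0. -/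
open scoped ComplexConjugate

local notation "⟪" x ", " y "⟫" => @inner ℂ _ _ x y

section Helpers

variable {H : Type*} [NormedAddCommGroup H] [InnerProductSpace ℂ H]

theorem aux_clm_ext {F : Type*} [NormedAddCommGroup F] [NormedSpace ℂ F] (e : ℕ → H)
    (hdense : Dense (Submodule.span ℂ (e '' {n : ℕ | 1 ≤ n}) : Set H))
    (A C : H →L[ℂ] F) (h : ∀ n, 1 ≤ n → A (e n) = C (e n)) : A = C := by
  apply ContinuousLinearMap.ext_on hdense
  rintro _ ⟨n, hn, rfl⟩
  exact h n hn

theorem aux_vec_ext (e : ℕ → H)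
    (hdense : Dense (Submodule.span ℂ (e '' {n : ℕ | 1 ≤ n}) : Set H))
    (x y : H) (h : ∀ n, 1 ≤ n → ⟪e n, x⟫ = ⟪e n, y⟫) : x = y := by
  have := aux_clm_ext e hdense (innerSL ℂ x) (innerSL ℂ y) (by
    intro n hn
    simp only [innerSL_apply_apply]
    rw [← inner_conj_symm, h n hn, inner_conj_symm])
  exact (innerSL_inj).1 this

theorem aux_inner_tau (e : ℕ → H)
    (horth : ∀ m n : ℕ, 1 ≤ m → 1 ≤ n → ⟪e m, e n⟫ = if m = n then (m : ℂ) else 0)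
    (hdense : Dense (Submodule.span ℂ (e '' {n : ℕ | 1 ≤ n}) : Set H))
    (τ : ℝ → (H →L[ℂ] H))
    (hτ : ∀ (θ : ℝ) (n : ℕ), 1 ≤ n →
      τ θ (e n) = Complex.exp (-Complex.I * n * θ) • e n) (θ : ℝ) (m : ℕ) (hm : 1 ≤ m) (g : H) :
    ⟪e m, τ θ g⟫ = Complex.exp (-Complex.I * m * θ) * ⟪e m, g⟫ := by
  have := aux_clm_ext e hdense ((innerSL ℂ (e m)).comp (τ θ))
    (Complex.exp (-Complex.I * m * θ) • innerSL ℂ (e m)) (by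
      intro n hn
      simp only [ContinuousLinearMap.comp_apply, innerSL_apply_apply, hτ θ n hn, inner_smul_right,
        horth m n hm hn, ContinuousLinearMap.smul_apply, smul_eq_mul]
      split_ifs with h
      · rw [h]
      · simp)
  simpa using congrArg (fun A : H →L[ℂ] ℂ => A g) this

theorem aux_norm_tau [CompleteSpace H] (e : ℕ → H)
    (horth : ∀ m n : ℕ, 1 ≤ m → 1 ≤ n → ⟪e m, e n⟫ = if m = n then (m : ℂ) else 0)
    (hdense : Dense (Submodule.span ℂ (e '' {n : ℕ | 1 ≤ n}) : Set H))
    (τ : ℝ → (H →L[ℂ] H))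
    (hτ : ∀ (θ : ℝ) (n : ℕ), 1 ≤ n →
      τ θ (e n) = Complex.exp (-Complex.I * n * θ) • e n) (θ : ℝ) (g : H) :
    ‖τ θ g‖ = ‖g‖ := by
  have h1 : (ContinuousLinearMap.adjoint (τ θ)).comp (τ θ) = ContinuousLinearMap.id ℂ H := by
    apply aux_clm_ext e hdense
    intro n hn
    apply aux_vec_ext e hdense
    intro m hm
    simp only [ContinuousLinearMap.comp_apply, ContinuousLinearMap.id_apply]
    rw [ContinuousLinearMap.adjoint_inner_right, hτ θ m hm, hτ θ n hn, inner_smul_left,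
      inner_smul_right, horth m n hm hn]
    split_ifs with h
    · subst h
      rw [← mul_assoc, ← Complex.exp_conj, ← Complex.exp_add]
      simp
    · simp
  have h2 : ⟪τ θ g, τ θ g⟫ = ⟪g, g⟫ := by
    rw [← ContinuousLinearMap.adjoint_inner_right]
    have := congrArg (fun A : H →L[ℂ] H => A g) h1
    simp only [ContinuousLinearMap.comp_apply, ContinuousLinearMap.id_apply] at this
    rw [this]
  rw [@norm_eq_sqrt_re_inner ℂ, @norm_eq_sqrt_re_inner ℂ, h2]

theorem aux_cont_tau [CompleteSpace H] (e : ℕ → H)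
    (horth : ∀ m n : ℕ, 1 ≤ m → 1 ≤ n → ⟪e m, e n⟫ = if m = n then (m : ℂ) else 0)
    (hdense : Dense (Submodule.span ℂ (e '' {n : ℕ | 1 ≤ n}) : Set H))
    (τ : ℝ → (H →L[ℂ] H))
    (hτ : ∀ (θ : ℝ) (n : ℕ), 1 ≤ n →
      τ θ (e n) = Complex.exp (-Complex.I * n * θ) • e n) :
    Continuous (fun p : H × ℝ => τ p.2 p.1) := by
  apply continuous_prod_of_dense_continuous_lipschitzWith _ 1 hdense
  · intro a ha
    induction ha using Submodule.span_induction with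
    | mem x hx =>
      obtain ⟨n, hn, rfl⟩ := hx
      simp only [hτ _ n hn]
      fun_prop
    | zero => simpa using continuous_const
    | add x y _ _ hx hy =>
      simp only [map_add]
      exact hx.add hy
    | smul a x _ hx =>
      simp only [map_smul]
      exact hx.const_smul a
  · intro θ
    apply LipschitzWith.of_dist_le_mul
    intro x y
    simp only [dist_eq_norm, NNReal.coe_one, one_mul]
    rw [← map_sub, aux_norm_tau e horth hdense τ hτ]

theorem aux_exp_integral (j : ℤ) :
    ∫ θ in (0 : ℝ)..(2 * Real.pi), Complex.exp (Complex.I * j * θ)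
      = if j = 0 then ((2 * Real.pi : ℝ) : ℂ) else 0 := by
  split_ifs with h
  · simp [h]
  · rw [integral_exp_mul_complex (by simp [h])]
    have : Complex.I * j * ((2 * Real.pi : ℝ) : ℂ) = j * (2 * Real.pi * Complex.I) := by
      push_cast; ring
    rw [this, Complex.exp_int_mul_two_pi_mul_I]
    simp

theorem aux_main [CompleteSpace H] (e : ℕ → H)
    (horth : ∀ m n : ℕ, 1 ≤ m → 1 ≤ n → ⟪e m, e n⟫ = if m = n then (m : ℂ) else 0)
    (hdense : Dense (Submodule.span ℂ (e '' {n : ℕ | 1 ≤ n}) : Set H))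
    (τ : ℝ → (H →L[ℂ] H))
    (hτ : ∀ (θ : ℝ) (n : ℕ), 1 ≤ n →
      τ θ (e n) = Complex.exp (-Complex.I * n * θ) • e n)
    (T : H →L[ℂ] H) (c : ℤ → ℂ)
    (hT : ∀ m n : ℕ, 1 ≤ m → 1 ≤ n → ⟪e m, T (e n)⟫ = (m : ℂ) * c ((m : ℤ) - n))
    (k : ℤ) (A : H →L[ℂ] H)
    (hA : ∀ m n : ℕ, 1 ≤ m → 1 ≤ n → ⟪e m, A (e n)⟫ = if (m : ℤ) - n - k = 0 then (m : ℂ) else 0)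
    (f : H) :
    (((2 * Real.pi : ℝ) : ℂ))⁻¹ •
            (∫ θ in (0 : ℝ)..(2 * Real.pi),
              Complex.exp (-Complex.I * k * θ) • (τ (-θ) (T (τ θ f))))
          = c k • (A f) := by
  have hc := aux_cont_tau e horth hdense τ hτ
  have hF : Continuous (fun p : H × ℝ =>
      Complex.exp (-Complex.I * k * p.2) • (τ (-p.2) (T (τ p.2 p.1)))) := by
    have h2 : Continuous (fun p : H × ℝ => ((T (τ p.2 p.1), -p.2) : H × ℝ)) :=
      (T.continuous.comp hc).prodMk continuous_snd.neg
    have h3 := hc.comp h2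
    refine Continuous.smul (by fun_prop) h3
  have hF1 : ∀ g : H, Continuous (fun θ : ℝ =>
      Complex.exp (-Complex.I * k * θ) • (τ (-θ) (T (τ θ g)))) := fun g =>
    hF.comp (continuous_const.prodMk continuous_id)
  have hL : Continuous (fun g : H => ∫ θ in (0 : ℝ)..(2 * Real.pi),
      Complex.exp (-Complex.I * k * θ) • (τ (-θ) (T (τ θ g)))) := by
    apply intervalIntegral.continuous_parametric_intervalIntegral_of_continuous'
    exact hF
  have hpi : ((2 * Real.pi : ℝ) : ℂ) ≠ 0 := by
    exact_mod_cast Real.two_pi_pos.ne'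
  have key : ∀ g ∈ (Submodule.span ℂ (e '' {n : ℕ | 1 ≤ n}) : Set H),
      (((2 * Real.pi : ℝ) : ℂ))⁻¹ •
            (∫ θ in (0 : ℝ)..(2 * Real.pi),
              Complex.exp (-Complex.I * k * θ) • (τ (-θ) (T (τ θ g))))
          = c k • (A g) := by
    intro g hg
    induction hg using Submodule.span_induction with
    | mem x hx =>
      obtain ⟨n, hn, rfl⟩ := hx
      apply aux_vec_ext e hdense
      intro m hm
      have h1 := ContinuousLinearMap.intervalIntegral_comp_comm (innerSL ℂ (e m))
        ((hF1 (e n)).intervalIntegrable (μ := MeasureTheory.volume) 0 (2 * Real.pi))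
      simp only [innerSL_apply_apply] at h1
      rw [inner_smul_right, inner_smul_right, hA m n hm hn, ← h1]
      have h2 : ∀ θ : ℝ, ⟪e m, Complex.exp (-Complex.I * k * θ) • (τ (-θ) (T (τ θ (e n))))⟫
          = Complex.exp (Complex.I * ((m : ℤ) - n - k : ℤ) * θ) * ((m : ℂ) * c ((m : ℤ) - n)) := by
        intro θ
        rw [inner_smul_right, aux_inner_tau e horth hdense τ hτ _ m hm, hτ θ n hn, map_smul,
          inner_smul_right, hT m n hm hn, ← mul_assoc, ← mul_assoc, ← Complex.exp_add,
          ← Complex.exp_add]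
        congr 2
        push_cast
        ring
      simp only [h2]
      rw [intervalIntegral.integral_mul_const, aux_exp_integral]
      split_ifs with h
      · have : (m : ℤ) - n = k := by omega
        rw [this]
        field_simp
      · simp
    | zero => simp
    | add x y _ _ hx hy =>
      simp only [map_add, smul_add]
      rw [intervalIntegral.integral_add ((hF1 x).intervalIntegrable _ _)
        ((hF1 y).intervalIntegrable _ _), smul_add, hx, hy]
    | smul a x _ hx =>
      simp only [map_smul]
      have : ∀ θ : ℝ, Complex.exp (-Complex.I * k * θ) • a • (τ (-θ) (T (τ θ x)))
         = a • Complex.exp (-Complex.I * k * θ) • (τ (-θ) (T (τ θ x))) := fun θ => smul_comm _ _ _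
      simp only [this]
      rw [intervalIntegral.integral_smul, smul_comm, hx, smul_comm]
  have := Continuous.ext_on hdense (hL.const_smul (((2 * Real.pi : ℝ) : ℂ))⁻¹)
    (A.continuous.const_smul (c k)) key
  exact congrFun this f

end Helpers

theorem statement7 {H : Type*} [NormedAddCommGroup H] [InnerProductSpace ℂ H]
    [CompleteSpace H]
    (e : ℕ → H)
    (horth : ∀ m n : ℕ, 1 ≤ m → 1 ≤ n → ⟪e m, e n⟫ = if m = n then (m : ℂ) else 0)
    (hdense : Dense (Submodule.span ℂ (e '' {n : ℕ | 1 ≤ n}) : Set H))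
    (S B : H →L[ℂ] H)
    (hS : ∀ n : ℕ, 1 ≤ n → S (e n) = e (n + 1))
    (hB1 : B (e 1) = 0)
    (hB : ∀ n : ℕ, 1 ≤ n → B (e (n + 1)) = e n)
    -- the translation unitaries `τ(θ) e_n = exp(−i n θ) e_n`
    (τ : ℝ → (H →L[ℂ] H))
    (hτ : ∀ (θ : ℝ) (n : ℕ), 1 ≤ n →
      τ θ (e n) = Complex.exp (-Complex.I * n * θ) • e n)
    (T : H →L[ℂ] H) (c : ℤ → ℂ)
    (hT : ∀ m n : ℕ, 1 ≤ m → 1 ≤ n → ⟪e m, T (e n)⟫ = (m : ℂ) * c ((m : ℤ) - n)) :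
    ∀ (k : ℤ) (f : H),
      (0 ≤ k →
        (((2 * Real.pi : ℝ) : ℂ))⁻¹ •
            (∫ θ in (0 : ℝ)..(2 * Real.pi),
              Complex.exp (-Complex.I * k * θ) • (τ (-θ) (T (τ θ f))))
          = c k • ((S ^ k.toNat) f)) ∧
      (k < 0 →
        (((2 * Real.pi : ℝ) : ℂ))⁻¹ •
            (∫ θ in (0 : ℝ)..(2 * Real.pi),
              Complex.exp (-Complex.I * k * θ) • (τ (-θ) (T (τ θ f))))
          = c k • ((B ^ (-k).toNat) f)) := by
  intro k f
  have hSp : ∀ j n : ℕ, 1 ≤ n → (S ^ j) (e n) = e (n + j) := by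
    intro j
    induction j with
    | zero => intro n _; simp
    | succ j ih =>
      intro n hn
      rw [pow_succ, ContinuousLinearMap.mul_apply, hS n hn, ih (n + 1) (by omega)]
      congr 1
      omega
  have hBp : ∀ j n : ℕ, 1 ≤ n → (B ^ j) (e n) = if j < n then e (n - j) else 0 := by
    intro j
    induction j with
    | zero => intro n hn; simp [show 0 < n from hn]
    | succ j ih =>
      intro n hn
      rw [pow_succ, ContinuousLinearMap.mul_apply]
      rcases Nat.lt_or_ge 1 n with h | h
      · obtain ⟨p, rfl⟩ : ∃ p, n = p + 1 := ⟨n - 1, by omega⟩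
        rw [hB p (by omega), ih p (by omega)]
        simp
      · obtain rfl : n = 1 := by omega
        simp [hB1]
  constructor
  · intro hk
    apply aux_main e horth hdense τ hτ T c hT
    intro m n hm hn
    rw [hSp _ n hn, horth m _ hm (by omega)]
    congr 1
    apply propext
    omega
  · intro hk
    apply aux_main e horth hdense τ hτ T c hT
    intro m n hm hn
    rw [hBp _ n hn]
    by_cases h : (-k).toNat < n
    · rw [if_pos h, horth m _ hm (by omega)]
      congr 1
      apply propext
      omega
    · rw [if_neg h, if_neg (by omega), inner_zero_right]
end

section
/- Let T be a bounded operator on H that has Toeplitz matrix with coefficient sequence c : ℤ → ℂ. Then for every f ∈ H, the Cesàro sums converge strongly to T f: as N → ∞, Σ_{k=0}^{N} (1 − k/(N+1))·c(k)·(S^k f) + Σ_{k=1}^{N} (1 − k/(N+1))·c(−k)·(B^k f) tends to T f in the norm of H. -/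
open scoped ComplexConjugate

local notation "⟪" x ", " y "⟫" => @inner ℂ _ _ x y

/-- Fejér weight. -/
noncomputable def fejW (N i j : ℕ) : ℝ :=
  if i ≤ j + N ∧ j ≤ i + N then 1 - |(i : ℝ) - j| / (N + 1) else 0

/-- Window indicator. -/
noncomputable def win (N l i : ℕ) : ℝ := if i ≤ l ∧ l ≤ i + N then 1 else 0

lemma win_sum_aux (N M i j : ℕ) (hij : i ≤ j) (hj : j < M) :
    ∑ l ∈ Finset.range (M + N), win N l i * win N l j = (N + 1) * fejW N i j := by
  have h : ∀ l, win N l i * win N l j = if j ≤ l ∧ l ≤ i + N then 1 else 0 := by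
    intro l
    unfold win
    by_cases h1 : j ≤ l ∧ l ≤ i + N
    · rw [if_pos (by omega), if_pos (by omega), if_pos h1]; norm_num
    · rw [if_neg h1]
      by_cases h2 : i ≤ l ∧ l ≤ i + N
      · rw [if_neg (show ¬ (j ≤ l ∧ l ≤ j + N) by omega)]; simp
      · rw [if_neg h2]; simp
  simp_rw [h]
  rw [← Finset.sum_filter]
  have h3 : (Finset.range (M + N)).filter (fun l => j ≤ l ∧ l ≤ i + N) = Finset.Icc j (i + N) := by
    ext l; simp; omega
  rw [h3, Finset.sum_const, Nat.card_Icc]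
  have hN : (N : ℝ) + 1 ≠ 0 := by positivity
  unfold fejW
  by_cases h4 : j ≤ i + N
  · rw [if_pos ⟨by omega, h4⟩, ← Nat.cast_smul_eq_nsmul ℝ, Nat.cast_sub (by omega)]
    have : |(i : ℝ) - j| = j - i := by
      rw [abs_sub_comm, abs_of_nonneg]
      have : (i : ℝ) ≤ j := by exact_mod_cast hij
      linarith
    rw [this]
    push_cast
    field_simp
    simp
    ring
  · rw [if_neg (by omega), show i + N + 1 - j = 0 by omega]; simp

lemma fejW_comm (N i j : ℕ) : fejW N i j = fejW N j i := by
  unfold fejW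
  rw [abs_sub_comm]
  simp only [and_comm]

lemma win_sum (N M i j : ℕ) (hi : i < M) (hj : j < M) :
    ∑ l ∈ Finset.range (M + N), win N l i * win N l j = (N + 1) * fejW N i j := by
  rcases le_total i j with h | h
  · exact win_sum_aux N M i j h hj
  · rw [fejW_comm, ← win_sum_aux N M j i h hi]
    exact Finset.sum_congr rfl fun _ _ => mul_comm _ _

lemma fejW_self (N i : ℕ) : fejW N i i = 1 := by simp [fejW]

lemma fejW_nonneg (N i j : ℕ) : 0 ≤ fejW N i j := by
  have := win_sum N (i + j + 1) i j (by omega) (by omega)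
  have h2 : 0 ≤ ∑ l ∈ Finset.range (i + j + 1 + N), win N l i * win N l j :=
    Finset.sum_nonneg fun l _ => by unfold win; split_ifs <;> norm_num
  rw [this] at h2
  exact nonneg_of_mul_nonneg_right h2 (by positivity)

lemma fejW_le_one (N i j : ℕ) : fejW N i j ≤ 1 := by
  unfold fejW
  split_ifs
  · have : 0 ≤ |(i : ℝ) - j| / (N + 1) := by positivity
    linarith
  · norm_num

lemma fejW_tendsto (i j : ℕ) :
    Filter.Tendsto (fun N => fejW N i j) Filter.atTop (nhds 1) := by
  have h : Filter.Tendsto (fun N : ℕ => 1 - |(i : ℝ) - j| / ((N : ℝ) + 1))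
      Filter.atTop (nhds (1 - 0)) := by
    refine tendsto_const_nhds.sub ?_
    exact tendsto_const_nhds.div_atTop
      (Filter.tendsto_atTop_add_const_right _ _ tendsto_natCast_atTop_atTop)
  rw [sub_zero] at h
  refine h.congr' ?_
  filter_upwards [Filter.eventually_ge_atTop (i + j)] with N hN
  rw [fejW, if_pos (by omega)]

section
variable {H : Type*} [NormedAddCommGroup H] [InnerProductSpace ℂ H]

lemma norm_sq_comb (b : ℕ → H) (hb : Orthonormal ℂ b) (M : ℕ) (a : ℕ → ℂ) :
    ‖∑ i ∈ Finset.range M, a i • b i‖ ^ 2 = ∑ i ∈ Finset.range M, ‖a i‖ ^ 2 := by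
  have h := hb.inner_sum a a (Finset.range M)
  rw [inner_self_eq_norm_sq_to_K] at h
  have h2 : ((‖∑ i ∈ Finset.range M, a i • b i‖ ^ 2 : ℝ) : ℂ)
      = ((∑ i ∈ Finset.range M, ‖a i‖ ^ 2 : ℝ) : ℂ) := by
    push_cast
    refine h.trans ?_
    refine Finset.sum_congr rfl fun i _ => ?_
    rw [Complex.conj_mul']
  exact_mod_cast h2

lemma finite_bound (b : ℕ → H) (hb : Orthonormal ℂ b) (A T : H →L[ℂ] H) (N : ℕ)
    (hA : ∀ i j, ⟪b i, A (b j)⟫ = (fejW N i j : ℂ) * ⟪b i, T (b j)⟫) (M : ℕ) (a d : ℕ → ℂ) :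
    ‖⟪∑ i ∈ Finset.range M, a i • b i, A (∑ i ∈ Finset.range M, d i • b i)⟫‖ ≤
      ‖T‖ * (‖∑ i ∈ Finset.range M, a i • b i‖ * ‖∑ i ∈ Finset.range M, d i • b i‖) := by
  have exp : ∀ (X : H →L[ℂ] H) (a d : ℕ → ℂ),
      ⟪∑ i ∈ Finset.range M, a i • b i, X (∑ i ∈ Finset.range M, d i • b i)⟫ =
      ∑ i ∈ Finset.range M, ∑ j ∈ Finset.range M, conj (a i) * d j * ⟪b i, X (b j)⟫ := by
    intro X a d
    rw [sum_inner]
    refine Finset.sum_congr rfl fun i _ => ?_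
    rw [map_sum, inner_sum]
    refine Finset.sum_congr rfl fun j _ => ?_
    rw [map_smul, inner_smul_left, inner_smul_right]
    ring
  set G : (ℕ → ℂ) → ℕ → H := fun a l => ∑ i ∈ Finset.range M, ((win N l i : ℂ) * a i) • b i with hG
  have key : ((N : ℂ) + 1) *
      ⟪∑ i ∈ Finset.range M, a i • b i, A (∑ i ∈ Finset.range M, d i • b i)⟫ =
      ∑ l ∈ Finset.range (M + N), ⟪G a l, T (G d l)⟫ := by
    simp only [hG, exp]
    conv_rhs => rw [Finset.sum_comm]
    rw [Finset.mul_sum]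
    refine Finset.sum_congr rfl fun i hi => ?_
    conv_rhs => rw [Finset.sum_comm]
    rw [Finset.mul_sum]
    refine Finset.sum_congr rfl fun j hj => ?_
    have hw := win_sum N M i j (Finset.mem_range.1 hi) (Finset.mem_range.1 hj)
    have hw' : ∑ l ∈ Finset.range (M + N), (win N l i : ℂ) * (win N l j : ℂ)
        = ((N : ℂ) + 1) * (fejW N i j : ℂ) := by exact_mod_cast congrArg (fun x : ℝ => (x : ℂ)) hw
    rw [hA]
    calc _ = (((N : ℂ) + 1) * (fejW N i j : ℂ)) * (conj (a i) * d j * ⟪b i, T (b j)⟫) := by ring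
      _ = _ := by
        rw [← hw', Finset.sum_mul]
        refine Finset.sum_congr rfl fun l _ => ?_
        rw [map_mul, Complex.conj_ofReal]; ring
  have hsq : ∀ a : ℕ → ℂ, ∑ l ∈ Finset.range (M + N), ‖G a l‖ ^ 2 =
      (N + 1) * ‖∑ i ∈ Finset.range M, a i • b i‖ ^ 2 := by
    intro a
    simp only [hG, norm_sq_comb b hb]
    rw [Finset.sum_comm, Finset.mul_sum]
    refine Finset.sum_congr rfl fun i hi => ?_
    have hw := win_sum N M i i (Finset.mem_range.1 hi) (Finset.mem_range.1 hi)
    rw [fejW_self, mul_one] at hw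
    rw [← hw, Finset.sum_mul]
    refine Finset.sum_congr rfl fun l _ => ?_
    rw [norm_mul, mul_pow, Complex.norm_real, Real.norm_eq_abs, sq_abs]; ring
  have hN : (0 : ℝ) < N + 1 := by positivity
  have h1 : (N + 1 : ℝ) *
      ‖⟪∑ i ∈ Finset.range M, a i • b i, A (∑ i ∈ Finset.range M, d i • b i)⟫‖ ≤
      ‖T‖ * ∑ l ∈ Finset.range (M + N), ‖G a l‖ * ‖G d l‖ := by
    have : (N + 1 : ℝ) = ‖((N : ℂ) + 1)‖ := by
      have : ((N : ℂ) + 1) = ((N + 1 : ℝ) : ℂ) := by push_cast; rfl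
      rw [this, Complex.norm_real, Real.norm_eq_abs, abs_of_pos hN]
    rw [this, ← norm_mul, key, Finset.mul_sum]
    refine (norm_sum_le _ _).trans (Finset.sum_le_sum fun l _ => ?_)
    calc _ ≤ ‖G a l‖ * ‖T (G d l)‖ := norm_inner_le_norm _ _
      _ ≤ ‖G a l‖ * (‖T‖ * ‖G d l‖) := by gcongr; exact T.le_opNorm _
      _ = _ := by ring
  have h2 := Real.sum_mul_le_sqrt_mul_sqrt (Finset.range (M + N)) (fun l => ‖G a l‖)
    (fun l => ‖G d l‖)
  rw [hsq, hsq, Real.sqrt_mul hN.le, Real.sqrt_mul hN.le, Real.sqrt_sq (norm_nonneg _),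
    Real.sqrt_sq (norm_nonneg _), mul_mul_mul_comm, Real.mul_self_sqrt hN.le] at h2
  have h3 := h1.trans (mul_le_mul_of_nonneg_left h2 (norm_nonneg T))
  rw [mul_left_comm] at h3
  exact le_of_mul_le_mul_left h3 hN

lemma full_bound (b : HilbertBasis ℕ ℂ H) (A T : H →L[ℂ] H) (N : ℕ)
    (hA : ∀ i j, ⟪b i, A (b j)⟫ = (fejW N i j : ℂ) * ⟪b i, T (b j)⟫) (f : H) :
    ‖A f‖ ≤ ‖T‖ * ‖f‖ := by
  have hlim : ∀ g : H, Filter.Tendsto (fun M => ∑ i ∈ Finset.range M, b.repr g i • b i)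
      Filter.atTop (nhds g) := fun g => (b.hasSum_repr g).tendsto_sum_nat
  have h : ‖⟪A f, A f⟫‖ ≤ ‖T‖ * (‖A f‖ * ‖f‖) := by
    refine le_of_tendsto_of_tendsto' (b := Filter.atTop) (f := fun M => ‖⟪∑ i ∈ Finset.range M, b.repr (A f) i • b i,
      A (∑ i ∈ Finset.range M, b.repr f i • b i)⟫‖) ?_ ?_
      (fun M => finite_bound b b.orthonormal A T N hA M (b.repr (A f)) (b.repr f))
    · exact ((hlim (A f)).inner ((A.continuous.tendsto f).comp (hlim f))).norm
    · exact tendsto_const_nhds.mul ((hlim _).norm.mul (hlim _).norm)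
  rw [inner_self_eq_norm_sq_to_K, norm_pow, RCLike.norm_ofReal, abs_norm] at h
  rcases eq_or_lt_of_le (norm_nonneg (A f)) with h0 | h0
  · rw [← h0]; positivity
  · refine le_of_mul_le_mul_left ?_ h0
    nlinarith

lemma conv_basis (b : HilbertBasis ℕ ℂ H) (A : ℕ → H →L[ℂ] H) (T : H →L[ℂ] H)
    (hA : ∀ N i j, ⟪b i, A N (b j)⟫ = (fejW N i j : ℂ) * ⟪b i, T (b j)⟫) (j : ℕ) :
    Filter.Tendsto (fun N => A N (b j)) Filter.atTop (nhds (T (b j))) := by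
  have hns : ∀ x : H, HasSum (fun i => ‖⟪b i, x⟫‖ ^ 2) (‖x‖ ^ 2) := by
    intro x
    have h := b.hasSum_inner_mul_inner x x
    rw [inner_self_eq_norm_sq_to_K] at h
    have h' := Complex.hasSum_re h
    convert h' using 1
    · funext i
      rw [← inner_conj_symm x, Complex.conj_mul']
      norm_cast
    · norm_cast
  rw [tendsto_iff_norm_sub_tendsto_zero]
  have h2 : Filter.Tendsto (fun N => ‖A N (b j) - T (b j)‖ ^ 2) Filter.atTop (nhds 0) := by
    have h3 : ∀ N, ‖A N (b j) - T (b j)‖ ^ 2 =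
        ∑' i, (1 - fejW N i j) ^ 2 * ‖⟪b i, T (b j)⟫‖ ^ 2 := by
      intro N
      rw [← (hns _).tsum_eq]
      refine tsum_congr fun i => ?_
      rw [inner_sub_right, hA, ← mul_pow]
      have : (fejW N i j : ℂ) * ⟪b i, T (b j)⟫ - ⟪b i, T (b j)⟫ =
        - (((1 - fejW N i j : ℝ) : ℂ) * ⟪b i, T (b j)⟫) := by push_cast; ring
      rw [this, norm_neg, norm_mul, Complex.norm_real, Real.norm_eq_abs, abs_of_nonneg]
      linarith [fejW_le_one N i j]
    simp_rw [h3]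
    have h0 : (0 : ℝ) = ∑' _ : ℕ, 0 := by simp
    rw [h0]
    refine tendsto_tsum_of_dominated_convergence (hns (T (b j))).summable ?_ ?_
    · intro i
      have := (((fejW_tendsto i j).const_sub 1).pow 2).mul_const (‖⟪b i, T (b j)⟫‖ ^ 2)
      simpa using this
    · refine Filter.Eventually.of_forall fun N i => ?_
      rw [Real.norm_eq_abs, abs_of_nonneg (by positivity)]
      have h1 := fejW_le_one N i j
      have h2 := fejW_nonneg N i j
      exact mul_le_of_le_one_left (by positivity) (by nlinarith)
  have h4 := h2.sqrt
  simpa using h4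

lemma conv_all (b : HilbertBasis ℕ ℂ H) (A : ℕ → H →L[ℂ] H) (T : H →L[ℂ] H)
    (hA : ∀ N i j, ⟪b i, A N (b j)⟫ = (fejW N i j : ℂ) * ⟪b i, T (b j)⟫) (f : H) :
    Filter.Tendsto (fun N => A N f) Filter.atTop (nhds (T f)) := by
  have hlim : Filter.Tendsto (fun M => ∑ i ∈ Finset.range M, b.repr f i • b i)
      Filter.atTop (nhds f) := (b.hasSum_repr f).tendsto_sum_nat
  rw [Metric.tendsto_atTop]
  intro ε hε
  have hpos : 0 < ε / (4 * (‖T‖ + 1)) := by positivity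
  obtain ⟨M, hM⟩ := (Metric.tendsto_atTop.1 hlim) _ hpos
  have hM := hM M le_rfl
  set g := ∑ i ∈ Finset.range M, b.repr f i • b i with hg
  have hgc : Filter.Tendsto (fun N => A N g) Filter.atTop (nhds (T g)) := by
    simp only [hg, map_sum, map_smul]
    exact tendsto_finsetSum _ fun i _ => (conv_basis b A T hA i).const_smul _
  obtain ⟨N0, hN0⟩ := (Metric.tendsto_atTop.1 hgc) (ε / 2) (by positivity)
  refine ⟨N0, fun N hN => ?_⟩
  have h1 := hN0 N hN
  rw [dist_eq_norm] at *
  have h2 := full_bound b (A N) T N (hA N) (g - f)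
  have h3 := T.le_opNorm (g - f)
  have h4 : ‖T‖ * ‖g - f‖ ≤ ε / 4 := by
    rw [lt_div_iff₀ (by positivity)] at hM
    nlinarith [norm_nonneg T, norm_nonneg (g - f)]
  have h5 : A N f - T f = (A N g - T g) - A N (g - f) + T (g - f) := by
    simp only [map_sub]; abel
  rw [h5]
  calc _ ≤ ‖A N g - T g‖ + ‖A N (g - f)‖ + ‖T (g - f)‖ :=
        (norm_add_le _ _).trans (by gcongr; exact norm_sub_le _ _)
    _ < ε := by linarith

end

theorem statement8 {H : Type*} [NormedAddCommGroup H] [InnerProductSpace ℂ H]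
    [CompleteSpace H]
    (e : ℕ → H)
    (horth : ∀ m n : ℕ, 1 ≤ m → 1 ≤ n → ⟪e m, e n⟫ = if m = n then (m : ℂ) else 0)
    (hdense : Dense (Submodule.span ℂ (e '' {n : ℕ | 1 ≤ n}) : Set H))
    (S B : H →L[ℂ] H)
    (hS : ∀ n : ℕ, 1 ≤ n → S (e n) = e (n + 1))
    (hB1 : B (e 1) = 0)
    (hB : ∀ n : ℕ, 1 ≤ n → B (e (n + 1)) = e n)
    (T : H →L[ℂ] H) (c : ℤ → ℂ)
    (hT : ∀ m n : ℕ, 1 ≤ m → 1 ≤ n → ⟪e m, T (e n)⟫ = (m : ℂ) * c ((m : ℤ) - n)) :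
    ∀ f : H,
      Filter.Tendsto
        (fun N : ℕ =>
          (∑ k ∈ Finset.range (N + 1),
              ((1 - (k : ℂ) / ((N : ℂ) + 1)) * c k) • ((S ^ k) f)) +
          ∑ k ∈ Finset.range N,
              ((1 - ((k : ℂ) + 1) / ((N : ℂ) + 1)) * c (-(k : ℤ) - 1)) • ((B ^ (k + 1)) f))
        Filter.atTop (nhds (T f)) := by
  intro f
  have hSk : ∀ k n : ℕ, (S ^ k) (e (n + 1)) = e (n + k + 1) := by
    intro k
    induction k with
    | zero => intro n; simp
    | succ k ih =>
      intro n
      rw [pow_succ, mul_apply_eq_comp, hS _ (by omega), ih (n + 1)]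
      congr 1; omega
  have hBk : ∀ k n : ℕ, (B ^ k) (e (n + 1)) = if k ≤ n then e (n - k + 1) else 0 := by
    intro k
    induction k with
    | zero => intro n; simp
    | succ k ih =>
      intro n
      rw [pow_succ, mul_apply_eq_comp]
      cases n with
      | zero => simp [hB1]
      | succ n =>
        rw [hB _ (by omega), ih n]
        simp
  let A : ℕ → H →L[ℂ] H := fun N =>
    (∑ k ∈ Finset.range (N + 1), ((1 - (k : ℂ) / ((N : ℂ) + 1)) * c k) • (S ^ k)) +
      ∑ k ∈ Finset.range N,
        ((1 - ((k : ℂ) + 1) / ((N : ℂ) + 1)) * c (-(k : ℤ) - 1)) • (B ^ (k + 1))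
  have hAapp : ∀ N f, A N f = (∑ k ∈ Finset.range (N + 1),
              ((1 - (k : ℂ) / ((N : ℂ) + 1)) * c k) • ((S ^ k) f)) +
          ∑ k ∈ Finset.range N,
              ((1 - ((k : ℂ) + 1) / ((N : ℂ) + 1)) * c (-(k : ℤ) - 1)) • ((B ^ (k + 1)) f) := by
    intro N f
    simp [A]
  have hAe : ∀ N i j, ⟪e (i + 1), A N (e (j + 1))⟫ =
      (fejW N i j : ℂ) * ⟪e (i + 1), T (e (j + 1))⟫ := by
    intro N i j
    rw [hT _ _ (by omega) (by omega), hAapp, inner_add_right, inner_sum, inner_sum]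
    simp only [inner_smul_right, hSk, hBk]
    have h2 : ∀ k, ⟪e (i + 1), if k + 1 ≤ j then e (j - (k + 1) + 1) else 0⟫ =
        if j = i + k + 1 then ((i + 1 : ℕ) : ℂ) else 0 := by
      intro k
      split_ifs with h1 h2 h2
      · rw [horth _ _ (by omega) (by omega), if_pos (by omega)]
      · rw [horth _ _ (by omega) (by omega), if_neg (by omega)]
      · omega
      · simp
    simp only [h2]
    have h1 : ∀ k, ⟪e (i + 1), e (j + k + 1)⟫ = if i = j + k then ((i + 1 : ℕ) : ℂ) else 0 := by
      intro k
      rw [horth _ _ (by omega) (by omega)]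
      simp
    simp only [h1]
    rcases le_or_gt j i with h | h
    · obtain ⟨d, rfl⟩ := Nat.exists_eq_add_of_le h
      rw [Finset.sum_eq_zero (s := Finset.range N)
        (fun k _ => by rw [if_neg (by omega), mul_zero]), add_zero]
      simp only [add_right_inj, mul_ite, mul_zero, Finset.sum_ite_eq, Finset.mem_range]
      unfold fejW
      by_cases hd : d < N + 1
      · rw [if_pos hd, if_pos (by omega)]
        have : ((j + d + 1 : ℕ) : ℤ) - (j + 1 : ℕ) = d := by push_cast; ring
        rw [this]
        have : |((j + d : ℕ) : ℝ) - j| = d := by push_cast; simp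
        rw [this]
        push_cast; ring
      · rw [if_neg hd, if_neg (by omega)]; simp
    · obtain ⟨d, rfl⟩ := Nat.exists_eq_add_of_lt h
      rw [Finset.sum_eq_zero (s := Finset.range (N + 1))
        (fun k _ => by rw [if_neg (by omega), mul_zero]), zero_add]
      have : ∀ k, (i + d + 1 = i + k + 1) = (d = k) := by intro k; simp
      simp only [this, mul_ite, mul_zero, Finset.sum_ite_eq, Finset.mem_range]
      unfold fejW
      by_cases hd : d < N
      · rw [if_pos hd, if_pos (by omega)]
        have : ((i + 1 : ℕ) : ℤ) - (i + d + 1 + 1 : ℕ) = -(d : ℤ) - 1 := by push_cast; ring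
        rw [this]
        have : |(i : ℝ) - (i + d + 1 : ℕ)| = d + 1 := by
          rw [abs_sub_comm, abs_of_nonneg] <;> push_cast
          · ring
          · have : (0 : ℝ) ≤ d := by positivity
            linarith
        rw [this]
        push_cast; ring
      · rw [if_neg hd, if_neg (by omega)]; simp
  let v : ℕ → H := fun i => (((Real.sqrt (i + 1))⁻¹ : ℝ) : ℂ) • e (i + 1)
  have hv : Orthonormal ℂ v := by
    rw [orthonormal_iff_ite]
    intro i j
    simp only [v, inner_smul_left, inner_smul_right, Complex.conj_ofReal]
    rw [horth _ _ (by omega) (by omega)]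
    by_cases hij : i = j
    · subst hij
      rw [if_pos rfl, if_pos rfl]
      have h0 : (0 : ℝ) < i + 1 := by positivity
      have : (Real.sqrt (i + 1))⁻¹ * ((Real.sqrt (i + 1))⁻¹ * ((i + 1 : ℕ) : ℝ)) = 1 := by
        rw [← mul_assoc, ← mul_inv, Real.mul_self_sqrt h0.le]
        push_cast
        field_simp
      exact_mod_cast congrArg (fun x : ℝ => (x : ℂ)) this
    · rw [if_neg (by omega), if_neg hij]; simp
  have hsp : ⊤ ≤ (Submodule.span ℂ (Set.range v)).topologicalClosure := by
    have hle : Submodule.span ℂ (e '' {n : ℕ | 1 ≤ n}) ≤ Submodule.span ℂ (Set.range v) := by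
      rw [Submodule.span_le]
      rintro _ ⟨n, hn, rfl⟩
      obtain ⟨m, rfl⟩ := Nat.exists_eq_add_of_le' (show 1 ≤ n from hn)
      have h0 : Real.sqrt (m + 1) ≠ 0 := by positivity
      have : e (m + 1) = ((Real.sqrt (m + 1) : ℝ) : ℂ) • v m := by
        simp only [v, smul_smul]
        rw [← Complex.ofReal_mul, mul_inv_cancel₀ h0]; simp
      rw [this]
      exact Submodule.smul_mem _ _ (Submodule.subset_span ⟨m, rfl⟩)
    rw [top_le_iff, ← Submodule.dense_iff_topologicalClosure_eq_top]
    exact hdense.mono hle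
  let b := HilbertBasis.mk hv hsp
  have hb : ∀ i, b i = v i := fun i => by simp [b]
  have hfin := conv_all b A T (fun N i j => by
    simp only [hb, v, map_smul, inner_smul_left, inner_smul_right, hAe]
    ring) f
  simpa only [hAapp] using hfin
end

section
/- For w ∈ 𝔻 define Ẽ_w(z) := (1 − |w|²)·z/(1 − conj(w)·z) for z ∈ 𝔻 (the normalized kernel ‖E_w‖^{-1} E_w of 𝒟₀, where E_w(z) = z/(1 − conj(w) z)). Then: (i) for every integer k ≥ 0 and every w ∈ 𝔻, ∫_𝔻 (d/dz)[z^k·Ẽ_w(z)] · conj(Ẽ_w′(z)) dA(z) = k·(1 − |w|²)·w^k + w^k (in particular, for k = 0, ∫_𝔻 |Ẽ_w′|² dA = 1, i.e. Ẽ_w is a unit vector in 𝒟₀); and (ii) for every integer k ≥ 1 and every w ∈ 𝔻, ∫_𝔻 conj(z)^k · Ẽ_w′(z) · conj(Ẽ_w′(z)) dA(z) = conj(w)^k. (These are the formulas ⟨T_{z^k} Ẽ_w, Ẽ_w⟩ = k(1−|w|²)w^k + w^k and ⟨T_{z̄^k} Ẽ_w, Ẽ_w⟩ = conj(w)^k.)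 -/
open MeasureTheory Metric
open scoped ENNReal ComplexConjugate

/-- The normalized reproducing kernel `Ẽ_w(z) = (1 − |w|²)·z / (1 − conj(w)·z)` of `𝒟₀`. -/
noncomputable def Etilde (w : ℂ) : ℂ → ℂ :=
  fun z => ((1 - ‖w‖ ^ 2 : ℝ) : ℂ) * z / (1 - conj w * z)

/-- Circle version of the Bergman reproducing formula. -/
lemma circle_part (g : ℂ → ℂ) (w : ℂ) (hw : ‖w‖ < 1)
    (hd : DifferentiableOn ℂ g (ball 0 1)) (r : ℝ) (h0 : 0 < r) (h1 : r < 1) :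
    ∫ θ in (-Real.pi)..Real.pi, g (circleMap 0 r θ) * conj ((1 - conj w * circleMap 0 r θ) ^ 2)⁻¹
      = 2 * Real.pi * (g (r ^ 2 * w) + r ^ 2 * w * deriv g (r ^ 2 * w)) := by
  have hrw : (r : ℂ) ^ 2 * w ∈ ball (0 : ℂ) r := by
    simp only [mem_ball_zero_iff, norm_mul, norm_pow, Complex.norm_real, Real.norm_eq_abs, sq_abs]
    have := norm_nonneg w
    nlinarith [mul_pos h0 h0]
  have hsub : closedBall (0 : ℂ) r ⊆ ball 0 1 := closedBall_subset_ball h1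
  have hrw1 : (r : ℂ) ^ 2 * w ∈ ball (0 : ℂ) 1 := hsub (ball_subset_closedBall hrw)
  have hd' : DifferentiableOn ℂ (fun z => z * g z) (ball 0 1) := differentiableOn_id.mul hd
  have key := Complex.two_pi_I_inv_smul_circleIntegral_sub_sq_inv_smul_of_differentiable
    isOpen_ball hsub hd' hrw
  have hder : deriv (fun z => z * g z) ((r : ℂ) ^ 2 * w)
      = g (r ^ 2 * w) + r ^ 2 * w * deriv g (r ^ 2 * w) := by
    have hg := (hd.differentiableAt (isOpen_ball.mem_nhds hrw1)).hasDerivAt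
    have := ((hasDerivAt_id ((r : ℂ) ^ 2 * w)).mul hg).deriv
    simp only [id, one_mul] at this
    exact this
  rw [hder] at key
  rw [← key, circleIntegral, smul_eq_mul]
  have hper : Function.Periodic (fun θ : ℝ => g (circleMap 0 r θ) *
      conj ((1 - conj w * circleMap 0 r θ) ^ 2)⁻¹) (2 * Real.pi) := by
    intro θ
    simp only [periodic_circleMap 0 r θ]
  have h2 := hper.intervalIntegral_add_eq (-Real.pi) 0
  rw [show -Real.pi + 2 * Real.pi = Real.pi by ring, zero_add] at h2
  rw [h2, ← mul_assoc, ← intervalIntegral.integral_const_mul]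
  apply intervalIntegral.integral_congr
  intro θ _
  simp only [deriv_circleMap, smul_eq_mul]
  have hz : ‖circleMap 0 r θ‖ = r := by simp [abs_of_pos h0]
  set z := circleMap 0 r θ with hzdef
  have hz0 : z ≠ 0 := by
    rw [← norm_pos_iff, hz]; exact h0
  have hzz : z * conj z = (r : ℂ) ^ 2 := by
    rw [Complex.mul_conj, Complex.normSq_eq_norm_sq, hz]; push_cast; ring
  have hne : z - (r : ℂ) ^ 2 * w ≠ 0 := by
    intro h
    rw [sub_eq_zero] at h
    rw [← h, mem_ball_zero_iff, hz] at hrw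
    exact lt_irrefl _ hrw
  have hfac : z * (1 - w * conj z) = z - (r : ℂ) ^ 2 * w := by
    rw [← hzz]; ring
  have hne2 : 1 - w * conj z ≠ 0 := by
    intro h; rw [h, mul_zero] at hfac; exact hne hfac.symm
  simp only [map_inv₀, map_pow, map_sub, map_one, map_mul, Complex.conj_conj]
  rw [← hfac]
  have hpi : (Real.pi : ℂ) ≠ 0 := by exact_mod_cast Real.pi_ne_zero
  have := Complex.I_ne_zero
  field_simp

lemma den_ne (w z : ℂ) (hw : ‖w‖ < 1) (hz : ‖z‖ ≤ 1) : 1 - conj w * z ≠ 0 := by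
  intro h
  rw [sub_eq_zero] at h
  have : ‖conj w * z‖ < 1 := by
    rw [norm_mul, Complex.norm_conj]
    nlinarith [norm_nonneg w, norm_nonneg z]
  rw [← h] at this
  simp at this

lemma radial_part (g : ℂ → ℂ) (w : ℂ) (hw : ‖w‖ < 1)
    (hd : DifferentiableOn ℂ g (ball 0 1)) :
    ∫ r in (0:ℝ)..1, (r : ℂ) * (2 * Real.pi * (g (r ^ 2 * w) + r ^ 2 * w * deriv g (r ^ 2 * w)))
      = Real.pi * g w := by
  have hmem : ∀ r ∈ Set.uIcc (0:ℝ) 1, (r : ℂ) ^ 2 * w ∈ ball (0 : ℂ) 1 := by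
    intro r hr
    rw [Set.uIcc_of_le zero_le_one] at hr
    simp only [mem_ball_zero_iff, norm_mul, norm_pow, Complex.norm_real, Real.norm_eq_abs, sq_abs]
    have := norm_nonneg w
    have : r ^ 2 ≤ 1 := by nlinarith [hr.1, hr.2]
    nlinarith
  have hcont : ContinuousOn (fun r : ℝ => (r : ℂ) ^ 2 * w) (Set.uIcc (0:ℝ) 1) := by fun_prop
  have hdd : ContinuousOn (deriv g) (ball 0 1) := (hd.deriv isOpen_ball).continuousOn
  have := intervalIntegral.integral_eq_sub_of_hasDerivAt (a := 0) (b := 1)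
    (f := fun r : ℝ => (Real.pi : ℂ) * ((r : ℂ) ^ 2 * g (r ^ 2 * w)))
    (f' := fun r : ℝ => (r : ℂ) * (2 * Real.pi * (g (r ^ 2 * w) + r ^ 2 * w * deriv g (r ^ 2 * w))))
    ?_ ?_
  · rw [this]; simp
  · intro r hr
    have hg := (hd.differentiableAt (isOpen_ball.mem_nhds (hmem r hr))).hasDerivAt
    have h1 : HasDerivAt (fun r : ℝ => (r : ℂ) ^ 2) (2 * r) r := by
      have := (hasDerivAt_pow 2 (r : ℂ)).comp_ofReal
      refine this.congr_deriv ?_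
      norm_num
    have h2 := h1.mul_const w
    have h3 := hg.comp r h2
    have h4 := (h1.mul h3).const_mul (Real.pi : ℂ)
    refine h4.congr_deriv ?_
    simp only [Function.comp_apply]
    ring
  · apply ContinuousOn.intervalIntegrable
    have e1 : ContinuousOn (fun r : ℝ => g ((r : ℂ) ^ 2 * w)) (Set.uIcc (0:ℝ) 1) :=
      hd.continuousOn.comp hcont hmem
    have e2 : ContinuousOn (fun r : ℝ => deriv g ((r : ℂ) ^ 2 * w)) (Set.uIcc (0:ℝ) 1) :=
      hdd.comp hcont hmem
    have e3 : ContinuousOn (fun r : ℝ => (r : ℂ)) (Set.uIcc (0:ℝ) 1) :=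
      Complex.continuous_ofReal.continuousOn
    exact e3.mul (continuousOn_const.mul (e1.add (hcont.mul e2)))

/-- Bergman reproducing formula. -/
lemma bergman (g : ℂ → ℂ) (w : ℂ) (hw : ‖w‖ < 1)
    (hd : DifferentiableOn ℂ g (ball 0 1)) (hc : ContinuousOn g (closedBall 0 1)) :
    ∫ z in ball (0 : ℂ) 1, g z * conj ((1 - conj w * z) ^ 2)⁻¹ ∂dA = g w := by
  set F : ℂ → ℂ := fun z => g z * conj ((1 - conj w * z) ^ 2)⁻¹ with hF
  have hFc : ContinuousOn F (closedBall 0 1) := by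
    apply hc.mul
    apply Complex.continuous_conj.comp_continuousOn
    apply ContinuousOn.inv₀ (by fun_prop)
    intro z hz
    exact pow_ne_zero 2 (den_ne w z hw (by simpa using hz))
  have hvol : ∫ z in ball (0 : ℂ) 1, F z = Real.pi * g w := by
    rw [← integral_indicator measurableSet_ball, ← Complex.integral_comp_polarCoord_symm]
    have hsymm : ∀ p : ℝ × ℝ, Complex.polarCoord.symm p = circleMap 0 p.1 p.2 := by
      intro p
      rw [Complex.polarCoord_symm_apply, circleMap, Complex.exp_mul_I]
      simp
    have e1 : ∫ p in polarCoord.target, p.1 • (ball (0 : ℂ) 1).indicator F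
          (Complex.polarCoord.symm p)
        = ∫ p in Set.Ioo (0:ℝ) 1 ×ˢ Set.Ioo (-Real.pi) Real.pi,
          (p.1 : ℂ) * F (circleMap 0 p.1 p.2) := by
      rw [← integral_indicator polarCoord.open_target.measurableSet,
        ← integral_indicator (measurableSet_Ioo.prod measurableSet_Ioo)]
      congr 1
      ext p
      simp only [Set.indicator, polarCoord_target, Set.mem_prod, Set.mem_Ioi, Set.mem_Ioo, hsymm,
        mem_ball_zero_iff, norm_circleMap_zero]
      by_cases hp : 0 < p.1
      · by_cases hp1 : p.1 < 1
        · simp [hp, hp1, abs_of_pos hp]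
        · simp [hp, hp1, abs_of_pos hp]
      · simp [hp]
    rw [e1, Measure.volume_eq_prod, setIntegral_prod]
    · have e2 : ∀ r ∈ Set.Ioo (0:ℝ) 1, (∫ θ in Set.Ioo (-Real.pi) Real.pi,
          (r : ℂ) * F (circleMap 0 r θ)) =
          (r : ℂ) * (2 * Real.pi * (g (r ^ 2 * w) + r ^ 2 * w * deriv g (r ^ 2 * w))) := by
        intro r hr
        rw [integral_const_mul, ← circle_part g w hw hd r hr.1 hr.2,
          intervalIntegral.integral_of_le (by linarith [Real.pi_pos]), integral_Ioc_eq_integral_Ioo]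
      rw [setIntegral_congr_fun measurableSet_Ioo e2, ← integral_Ioc_eq_integral_Ioo,
        ← intervalIntegral.integral_of_le zero_le_one, radial_part g w hw hd]
    · have hk : IsCompact (Set.Icc (0:ℝ) 1 ×ˢ Set.Icc (-Real.pi) Real.pi) :=
        isCompact_Icc.prod isCompact_Icc
      apply IntegrableOn.mono_set (t := Set.Icc (0:ℝ) 1 ×ˢ Set.Icc (-Real.pi) Real.pi)
      · apply ContinuousOn.integrableOn_compact' hk hk.measurableSet
        apply ContinuousOn.mul (by fun_prop)
        apply hFc.comp
        · unfold circleMap; fun_prop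
        · rintro ⟨r, θ⟩ ⟨hr, -⟩
          simp only [mem_closedBall_zero_iff, norm_circleMap_zero, abs_of_nonneg hr.1]
          exact hr.2
      · exact Set.prod_mono Set.Ioo_subset_Icc_self Set.Ioo_subset_Icc_self
  rw [dA, Measure.restrict_smul, integral_smul_measure, hvol,
    ENNReal.toReal_ofReal (by positivity), Complex.real_smul]
  have hpi : (Real.pi : ℂ) ≠ 0 := by exact_mod_cast Real.pi_ne_zero
  push_cast
  field_simp

lemma hasDerivAt_Etilde (w z : ℂ) (hw : ‖w‖ < 1) (hz : ‖z‖ ≤ 1) :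
    HasDerivAt (Etilde w) (((1 - ‖w‖ ^ 2 : ℝ) : ℂ) * ((1 - conj w * z) ^ 2)⁻¹) z := by
  have hne := den_ne w z hw hz
  have h1 := (hasDerivAt_id z).const_mul ((1 - ‖w‖ ^ 2 : ℝ) : ℂ)
  have h2 := ((hasDerivAt_id z).const_mul (conj w)).const_sub 1
  have h3 := h1.div h2 hne
  refine h3.congr_deriv ?_
  simp only [id_eq, mul_one]
  field_simp
  ring

lemma s_eq (w : ℂ) : 1 - conj w * w = ((1 - ‖w‖ ^ 2 : ℝ) : ℂ) := by
  rw [mul_comm, Complex.mul_conj, Complex.normSq_eq_norm_sq]; push_cast; ring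

lemma s_ne (w : ℂ) (hw : ‖w‖ < 1) : ((1 - ‖w‖ ^ 2 : ℝ) : ℂ) ≠ 0 := by
  rw [← s_eq]; exact den_ne w w hw hw.le

lemma bergman_E (g : ℂ → ℂ) (w : ℂ) (hw : ‖w‖ < 1)
    (hd : DifferentiableOn ℂ g (ball 0 1)) (hc : ContinuousOn g (closedBall 0 1)) :
    ∫ z in ball (0 : ℂ) 1, g z * conj (deriv (Etilde w) z) ∂dA
      = ((1 - ‖w‖ ^ 2 : ℝ) : ℂ) * g w := by
  rw [← bergman g w hw hd hc, ← integral_const_mul]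
  apply setIntegral_congr_fun measurableSet_ball
  intro z hz
  have hz' : ‖z‖ ≤ 1 := by simpa using (mem_ball_zero_iff.1 hz).le
  simp only
  rw [(hasDerivAt_Etilde w z hw hz').deriv, map_mul, Complex.conj_ofReal]
  ring

/-- Explicit derivative of `z ^ k * Etilde w z`. -/
lemma part_one (k : ℕ) (w : ℂ) (hw : ‖w‖ < 1) :
    (∫ z in ball (0 : ℂ) 1,
          deriv (fun z => z ^ k * Etilde w z) z * conj (deriv (Etilde w) z) ∂dA)
        = (k : ℂ) * ((1 - ‖w‖ ^ 2 : ℝ) : ℂ) * w ^ k + w ^ k := by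
  have hD : ∀ z : ℂ, ‖z‖ ≤ 1 → deriv (fun z => z ^ k * Etilde w z) z =
      (k : ℂ) * z ^ (k - 1) * (((1 - ‖w‖ ^ 2 : ℝ) : ℂ) * z / (1 - conj w * z)) +
        z ^ k * (((1 - ‖w‖ ^ 2 : ℝ) : ℂ) * ((1 - conj w * z) ^ 2)⁻¹) := by
    intro z hz
    exact ((hasDerivAt_pow k z).mul (hasDerivAt_Etilde w z hw hz)).deriv
  have hdiff : ∀ z : ℂ, ‖z‖ ≤ 1 → DifferentiableAt ℂ (fun z : ℂ =>
      (k : ℂ) * z ^ (k - 1) * (((1 - ‖w‖ ^ 2 : ℝ) : ℂ) * z / (1 - conj w * z)) +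
        z ^ k * (((1 - ‖w‖ ^ 2 : ℝ) : ℂ) * ((1 - conj w * z) ^ 2)⁻¹)) z := by
    intro z hz
    have h1 := den_ne w z hw hz
    have h2 := pow_ne_zero 2 h1
    fun_prop (disch := assumption)
  have := bergman_E _ w hw
    (fun z hz => (hdiff z (mem_ball_zero_iff.1 hz).le).differentiableWithinAt)
    (fun z hz => (hdiff z (mem_closedBall_zero_iff.1 hz)).continuousAt.continuousWithinAt)
  rw [setIntegral_congr_fun measurableSet_ball (fun z hz => by
    rw [hD z (mem_ball_zero_iff.1 hz).le]), this, s_eq]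
  have hs := s_ne w hw
  rcases k with _ | k
  · simp only [pow_zero, Nat.cast_zero]
    field_simp
    ring
  · simp only [Nat.add_sub_cancel]
    field_simp
    ring

lemma part_three (k : ℕ) (w : ℂ) (hw : ‖w‖ < 1) :
    (∫ z in ball (0 : ℂ) 1,
          (conj z) ^ k * deriv (Etilde w) z * conj (deriv (Etilde w) z) ∂dA)
        = (conj w) ^ k := by
  have hdiff : ∀ z : ℂ, ‖z‖ ≤ 1 → DifferentiableAt ℂ (fun z : ℂ =>
        z ^ k * (((1 - ‖w‖ ^ 2 : ℝ) : ℂ) * ((1 - conj w * z) ^ 2)⁻¹)) z := by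
    intro z hz
    have h1 := den_ne w z hw hz
    have h2 := pow_ne_zero 2 h1
    fun_prop (disch := assumption)
  have := bergman_E _ w hw
    (fun z hz => (hdiff z (mem_ball_zero_iff.1 hz).le).differentiableWithinAt)
    (fun z hz => (hdiff z (mem_closedBall_zero_iff.1 hz)).continuousAt.continuousWithinAt)
  have h3 := congrArg conj this
  rw [← integral_conj] at h3
  have hs := s_ne w hw
  have h4 : ((1 - ‖w‖ ^ 2 : ℝ) : ℂ) *
      (w ^ k * (((1 - ‖w‖ ^ 2 : ℝ) : ℂ) * ((1 - conj w * w) ^ 2)⁻¹)) = w ^ k := by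
    rw [s_eq]; field_simp
  rw [h4, map_pow] at h3
  rw [← h3]
  apply setIntegral_congr_fun measurableSet_ball
  intro z hz
  simp only
  rw [← (hasDerivAt_Etilde w z hw (mem_ball_zero_iff.1 hz).le).deriv]
  simp only [map_mul, map_pow, Complex.conj_conj]
  ring

theorem statement14 :
    (∀ (k : ℕ) (w : ℂ), w ∈ ball (0 : ℂ) 1 →
      (∫ z in ball (0 : ℂ) 1,
          deriv (fun z => z ^ k * Etilde w z) z * conj (deriv (Etilde w) z) ∂dA)
        = (k : ℂ) * ((1 - ‖w‖ ^ 2 : ℝ) : ℂ) * w ^ k + w ^ k) ∧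
    (∀ w ∈ ball (0 : ℂ) 1,
      (∫ z in ball (0 : ℂ) 1, ‖deriv (Etilde w) z‖ ^ 2 ∂dA) = 1) ∧
    (∀ k : ℕ, 1 ≤ k → ∀ w ∈ ball (0 : ℂ) 1,
      (∫ z in ball (0 : ℂ) 1,
          (conj z) ^ k * deriv (Etilde w) z * conj (deriv (Etilde w) z) ∂dA)
        = (conj w) ^ k) := by

  refine ⟨fun k w hw => part_one k w (mem_ball_zero_iff.1 hw), fun w hw => ?_,
    fun k _ w hw => part_three k w (mem_ball_zero_iff.1 hw)⟩
  have h := part_three 0 w (mem_ball_zero_iff.1 hw)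
  simp only [pow_zero, one_mul, Complex.mul_conj, Complex.normSq_eq_norm_sq] at h
  rw [integral_complex_ofReal] at h
  exact_mod_cast h
end
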